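/- Let I₀ ⊂ ℝ be an interval, f ∈ C³(I₀), and C_f := {(x, f(x)) : x ∈ I₀}; assume there exists at least one point x₀ ∈ I₀ with f''(x₀) ≠ 0. Let ψ be an approximating function and let h be a dimension function such that r^{−1} h(r) → ∞ as r → 0, r ↦ r^{−1} h(r) is decreasing, and r^{−(1/2+ε)} h(r) → 0 as r → 0 for all sufficiently small ε > 0. Suppose moreover h satisfies the growth condition: there exist constants r₀, λ₁, λ₂ ∈ (0, 1) such that h(λ₁ r) ≤ λ₂ h(r) for all r ∈ (0, r₀). If ∑_{r=1}^∞ r ψ(r) h(ψ(r)/r) = ∞, then ℋ^h(C_f ∩ S₂(ψ)) = ∞. -/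

import Mathlib

open MeasureTheory Filter

/-- The distance from a real number to the nearest integer. -/
noncomputable def distNearestInt (x : ℝ) : ℝ := |x - round x|

/-- An approximating function: a decreasing function `ℝ₊ → ℝ₊` taking positive values. -/
def IsApproxFun (ψ : ℝ → ℝ) : Prop :=
  (∀ x y : ℝ, 0 < x → x ≤ y → ψ y ≤ ψ x) ∧ ∀ x : ℝ, 0 < x → 0 < ψ x

/-- The set `S₂(ψ)` of simultaneously `ψ`-approximable points of the plane. -/
def SimApprox2 (ψ : ℝ → ℝ) : Set (ℝ × ℝ) :=
  {y : ℝ × ℝ |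
    {q : ℕ | 0 < q ∧
      max (distNearestInt (q * y.1)) (distNearestInt (q * y.2)) < ψ q}.Infinite}

/-- A dimension function: an increasing continuous function `h : ℝ₊ → ℝ₊` with
`h(r) → 0` as `r → 0`. -/
def IsDimFun (h : ℝ → ℝ) : Prop :=
  MonotoneOn h (Set.Ioi 0) ∧ ContinuousOn h (Set.Ioi 0) ∧
    (∀ r : ℝ, 0 < r → 0 < h r) ∧
    Tendsto h (nhdsWithin 0 (Set.Ioi 0)) (nhds 0)

/-- The Hausdorff measure `ℋ^h` on `ℝ²` with gauge (dimension function) `h`. -/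
noncomputable def hausdorffGaugeMeasure (h : ℝ → ℝ) : Measure (ℝ × ℝ) :=
  Measure.mkMetric (fun r : ENNReal => ENNReal.ofReal (h r.toReal))

/-- The mean value theorem between two points in arbitrary order. -/
lemma exists_slope_uIcc {F F' : ℝ → ℝ} {s t : ℝ}
    (hF : ∀ x ∈ Set.uIcc s t, HasDerivAt F (F' x) x) :
    ∃ ξ ∈ Set.uIcc s t, F t - F s = F' ξ * (t - s) := by
  rcases lt_trichotomy s t with hst | hst | hst
  · rw [Set.uIcc_of_le hst.le] at *
    obtain ⟨c, hc, hc'⟩ := exists_hasDerivAt_eq_slope F F' hst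
      (fun x hx => (hF x hx).continuousAt.continuousWithinAt)
      (fun x hx => hF x (Set.Ioo_subset_Icc_self hx))
    refine ⟨c, Set.Ioo_subset_Icc_self hc, ?_⟩
    rw [hc', div_mul_cancel₀ _ (sub_ne_zero.2 hst.ne')]
  · subst hst
    exact ⟨s, by simp, by simp⟩
  · rw [Set.uIcc_of_ge hst.le] at *
    obtain ⟨c, hc, hc'⟩ := exists_hasDerivAt_eq_slope F F' hst
      (fun x hx => (hF x hx).continuousAt.continuousWithinAt)
      (fun x hx => hF x (Set.Ioo_subset_Icc_self hx))
    refine ⟨c, Set.Ioo_subset_Icc_self hc, ?_⟩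
    rw [hc', div_mul_eq_mul_div, eq_div_iff (sub_ne_zero.2 hst.ne')]
    ring

lemma volume_le_ofReal_of_abs_sub_le {S : Set ℝ} {d : ℝ}
    (hS : ∀ s ∈ S, ∀ t ∈ S, |s - t| ≤ d) : volume S ≤ ENNReal.ofReal d := by
  refine (Real.volume_le_diam S).trans (Metric.ediam_le fun s hs t ht => ?_)
  rw [edist_dist, Real.dist_eq]
  exact ENNReal.ofReal_le_ofReal (hS s hs t ht)

/-- A function which expands distances by a factor `m` on `S` and is bounded by `e` there
forces `S` to have measure at most `2 * e / m`. -/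
lemma volume_le_of_expanding {S : Set ℝ} {F : ℝ → ℝ} {m e : ℝ} (hm : 0 < m)
    (hF : ∀ s ∈ S, ∀ t ∈ S, m * |s - t| ≤ |F s - F t|) (he : ∀ s ∈ S, |F s| ≤ e) :
    volume S ≤ ENNReal.ofReal (2 * e / m) := by
  refine volume_le_ofReal_of_abs_sub_le fun s hs t ht => ?_
  rw [le_div_iff₀ hm]
  have := hF s hs t ht
  have h3 := abs_sub (F s) (F t)
  have h1 := he s hs
  have h2 := he t ht
  linarith

lemma uIcc_subset_closedBall {x r s t : ℝ} (hs : s ∈ Metric.closedBall x r)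
    (ht : t ∈ Metric.closedBall x r) : Set.uIcc s t ⊆ Metric.closedBall x r := by
  rw [Real.closedBall_eq_Icc] at *
  exact Set.ordConnected_Icc.uIcc_subset hs ht

set_option maxHeartbeats 800000 in
/-- Quantitative smallness of the set where a function `g` with `g' = w' u`, `u' = k w` and the
function `u` are both small, when one of them is large somewhere in the ball. -/
lemma volume_both_small_le {c₁ c₂ : ℝ} (hc₁ : 0 < c₁) (h12 : c₁ ≤ c₂) {k : ℝ}
    {u g w w' : ℝ → ℝ} {x₀ r : ℝ} (hr : 0 < r)
    (hu : ∀ x ∈ Metric.closedBall x₀ r, HasDerivAt u (k * w x) x)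
    (hg : ∀ x ∈ Metric.closedBall x₀ r, HasDerivAt g (w' x * u x) x)
    (hw : ∀ x ∈ Metric.closedBall x₀ r, w x ∈ Set.Icc c₁ c₂)
    (hw' : ∀ x ∈ Metric.closedBall x₀ r, w' x ∈ Set.Icc c₁ c₂)
    {U V ε ρ θ : ℝ} (hU : 0 < U) (hV : 0 < V) (hε : 0 < ε) (hρ : 0 < ρ) (hθ : 0 < θ)
    (hθ2 : θ ≤ 1 / 2) (hερ : ε ≤ θ ^ 2 * ρ)
    (hu0 : |u x₀| ≤ ε * U) (hg0 : |g x₀| ≤ ε * V) {y : ℝ} (hy : y ∈ Metric.closedBall x₀ r)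
    (hyb : ρ * U ≤ |u y| ∨ ρ * V ≤ |g y|) :
    volume {x | x ∈ Metric.closedBall x₀ r ∧ |u x| ≤ ε * U ∧ |g x| ≤ ε * V} ≤
      ENNReal.ofReal (16 * (c₂ / c₁) * θ * r) := by
  have hc₂ : 0 < c₂ := hc₁.trans_le h12
  have hx₀ : x₀ ∈ Metric.closedBall x₀ r := Metric.mem_closedBall_self hr.le
  have hεh : ε ≤ ρ / 2 := by
    have : θ ^ 2 ≤ 1 / 2 := by nlinarith
    nlinarith
  have hdist : ∀ s ∈ Metric.closedBall x₀ r, ∀ t ∈ Metric.closedBall x₀ r, |s - t| ≤ 2 * r := by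
    intro s hs t ht
    rw [Metric.mem_closedBall, Real.dist_eq] at hs ht
    have := abs_sub (s - x₀) (t - x₀)
    have e : s - x₀ - (t - x₀) = s - t := by ring
    rw [e] at this
    linarith
  have hyd : |y - x₀| ≤ r := by rwa [Metric.mem_closedBall, Real.dist_eq] at hy
  have uslope : ∀ s ∈ Metric.closedBall x₀ r, ∀ t ∈ Metric.closedBall x₀ r,
      ∃ a ∈ Set.Icc c₁ c₂, u t - u s = k * a * (t - s) := by
    intro s hs t ht
    obtain ⟨ξ, hξ, h⟩ := exists_slope_uIcc
      (fun x hx => hu x (uIcc_subset_closedBall hs ht hx))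
    exact ⟨w ξ, hw ξ (uIcc_subset_closedBall hs ht hξ), h⟩
  have ulow : ∀ s ∈ Metric.closedBall x₀ r, ∀ t ∈ Metric.closedBall x₀ r,
      |k| * c₁ * |s - t| ≤ |u s - u t| := by
    intro s hs t ht
    obtain ⟨a, ha, h⟩ := uslope t ht s hs
    rw [h, abs_mul, abs_mul, abs_of_pos (hc₁.trans_le ha.1)]
    have := ha.1
    gcongr
  have uup : ∀ s ∈ Metric.closedBall x₀ r, ∀ t ∈ Metric.closedBall x₀ r,
      |u s - u t| ≤ |k| * c₂ * |s - t| := by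
    intro s hs t ht
    obtain ⟨a, ha, h⟩ := uslope t ht s hs
    rw [h, abs_mul, abs_mul, abs_of_pos (hc₁.trans_le ha.1)]
    have := ha.2
    gcongr
  rcases hyb with hyb | hyb
  · have h1 : ρ * U / 2 ≤ |k| * c₂ * r := by
      have h2 := uup y hy x₀ hx₀
      have h3 := abs_sub_abs_le_abs_sub (u y) (u x₀)
      have h4 : |k| * c₂ * |y - x₀| ≤ |k| * c₂ * r := by gcongr
      nlinarith
    have hk : 0 < |k| := by
      rcases (abs_nonneg k).lt_or_eq with h | h
      · exact h
      · rw [← h] at h1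
        have : 0 < ρ * U := by positivity
        nlinarith
    refine (volume_le_of_expanding (F := u) (m := |k| * c₁) (e := ε * U) (by positivity)
      (fun s hs t ht => ulow s hs.1 t ht.1) (fun s hs => hs.2.1)).trans
      (ENNReal.ofReal_le_ofReal ?_)
    rw [div_le_iff₀ (by positivity)]
    have e : 16 * (c₂ / c₁) * θ * r * (|k| * c₁) = 16 * θ * (|k| * c₂ * r) := by
      field_simp
    rw [e]
    have h5 : θ ^ 2 * ρ ≤ θ * ρ := by nlinarith [mul_pos hθ hρ]
    have h6 : ε * U ≤ θ * (ρ * U) := by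
      nlinarith
    nlinarith [mul_pos hθ (mul_pos hρ hU)]
  · obtain ⟨ξ, hξ, hS⟩ : ∃ ξ ∈ Metric.closedBall x₀ r, ρ * V / (2 * r * c₂) ≤ |u ξ| := by
      obtain ⟨ξ, hξ, h⟩ := exists_slope_uIcc
        (fun x hx => hg x (uIcc_subset_closedBall hx₀ hy hx))
      have hξ' := uIcc_subset_closedBall hx₀ hy hξ
      refine ⟨ξ, hξ', ?_⟩
      rw [div_le_iff₀ (by positivity)]
      have h3 := abs_sub_abs_le_abs_sub (g y) (g x₀)
      rw [h, abs_mul, abs_mul, abs_of_pos (hc₁.trans_le (hw' ξ hξ').1)] at h3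
      have h4 : w' ξ * |u ξ| * |y - x₀| ≤ c₂ * |u ξ| * r := by
        have := (hw' ξ hξ').2
        gcongr
      nlinarith
    set S := ρ * V / (2 * r * c₂) with hSdef
    have hSpos : 0 < S := by positivity
    have hSe : ρ * V = S * (2 * r * c₂) := by
      rw [hSdef]; field_simp
    have hεV : ε * V ≤ θ ^ 2 * (S * (2 * r * c₂)) := by
      rw [← hSe]; nlinarith
    set B := Metric.closedBall x₀ r
    have hsub : {x | x ∈ B ∧ |u x| ≤ ε * U ∧ |g x| ≤ ε * V} ⊆
        {x | x ∈ B ∧ |u x| ≤ θ * S} ∪ ({x | x ∈ B ∧ θ * S < u x ∧ |g x| ≤ ε * V} ∪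
          {x | x ∈ B ∧ u x < -(θ * S) ∧ |g x| ≤ ε * V}) := by
      rintro x ⟨hxB, -, hx⟩
      by_cases h : |u x| ≤ θ * S
      · exact Or.inl ⟨hxB, h⟩
      · rw [not_le, lt_abs] at h
        rcases h with h | h
        · exact Or.inr (Or.inl ⟨hxB, h, hx⟩)
        · exact Or.inr (Or.inr ⟨hxB, by linarith, hx⟩)
    have hA : volume {x | x ∈ B ∧ |u x| ≤ θ * S} ≤ ENNReal.ofReal (8 * (c₂ / c₁) * θ * r) := by
      by_cases hne : ∃ s, s ∈ B ∧ |u s| ≤ θ * S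
      · obtain ⟨s, hs, hus⟩ := hne
        have h1 : S / 2 ≤ |k| * c₂ * (2 * r) := by
          have h2 := uup ξ hξ s hs
          have h3 := abs_sub_abs_le_abs_sub (u ξ) (u s)
          have h4 : |k| * c₂ * |ξ - s| ≤ |k| * c₂ * (2 * r) := by
            have := hdist ξ hξ s hs
            gcongr
          nlinarith
        have hk : 0 < |k| := by
          rcases (abs_nonneg k).lt_or_eq with h | h
          · exact h
          · rw [← h] at h1
            nlinarith
        refine (volume_le_of_expanding (F := u) (m := |k| * c₁) (e := θ * S) (by positivity)
          (fun s hs t ht => ulow s hs.1 t ht.1) (fun s hs => hs.2)).trans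
          (ENNReal.ofReal_le_ofReal ?_)
        rw [div_le_iff₀ (by positivity)]
        have e : 8 * (c₂ / c₁) * θ * r * (|k| * c₁) = 4 * θ * (|k| * c₂ * (2 * r)) := by
          field_simp; ring
        rw [e]
        nlinarith
      · have : {x | x ∈ B ∧ |u x| ≤ θ * S} = ∅ := by
          exact Set.eq_empty_of_forall_notMem fun x hx => hne ⟨x, hx⟩
        rw [this]; simp
    have hbound : 2 * (ε * V) / (c₁ * (θ * S)) ≤ 4 * (c₂ / c₁) * θ * r := by
      rw [div_le_iff₀ (by positivity)]
      have e : 4 * (c₂ / c₁) * θ * r * (c₁ * (θ * S)) = 2 * (θ ^ 2 * (S * (2 * r * c₂))) := by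
        field_simp; ring
      rw [e]; linarith
    have ubetween : ∀ s ∈ B, ∀ t ∈ B, ∀ η ∈ Set.uIcc s t, u η ∈ Set.uIcc (u s) (u t) := by
      intro s hs t ht η hη
      have hηB := uIcc_subset_closedBall hs ht hη
      obtain ⟨a, ha, h⟩ := uslope s hs η hηB
      obtain ⟨b, hb, h'⟩ := uslope η hηB t ht
      have ha' := hc₁.trans_le ha.1
      have hb' := hc₁.trans_le hb.1
      have hprod : 0 ≤ (η - s) * (t - η) := by
        rcases Set.mem_uIcc.1 hη with h | h
        · exact mul_nonneg (by linarith) (by linarith)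
        · exact mul_nonneg_of_nonpos_of_nonpos (by linarith) (by linarith)
      have : 0 ≤ (u η - u s) * (u t - u η) := by
        rw [h, h']
        have e : k * a * (η - s) * (k * b * (t - η)) = k ^ 2 * (a * b) * ((η - s) * (t - η)) := by
          ring
        rw [e]; positivity
      rw [Set.mem_uIcc]
      rcases mul_nonneg_iff.1 this with ⟨h1, h2⟩ | ⟨h1, h2⟩
      · exact Or.inl ⟨by linarith, by linarith⟩
      · exact Or.inr ⟨by linarith, by linarith⟩
    have gslope : ∀ s ∈ B, ∀ t ∈ B, ∃ η ∈ Set.uIcc s t, ∃ a, c₁ ≤ a ∧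
        g s - g t = a * u η * (s - t) := by
      intro s hs t ht
      obtain ⟨ξ, hξ, h⟩ := exists_slope_uIcc
        (fun x hx => hg x (uIcc_subset_closedBall ht hs hx))
      exact ⟨ξ, by rwa [Set.uIcc_comm], w' ξ, (hw' ξ (uIcc_subset_closedBall ht hs hξ)).1, h⟩
    have hB1 : volume {x | x ∈ B ∧ θ * S < u x ∧ |g x| ≤ ε * V} ≤
        ENNReal.ofReal (4 * (c₂ / c₁) * θ * r) := by
      refine (volume_le_of_expanding (F := g) (m := c₁ * (θ * S)) (e := ε * V) (by positivity)
        ?_ (fun s hs => hs.2.2)).trans (ENNReal.ofReal_le_ofReal hbound)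
      intro s hs t ht
      obtain ⟨η, hη, a, ha, h⟩ := gslope s hs.1 t ht.1
      have h1 : θ * S ≤ u η := by
        have h2 := hs.2.1
        have h3 := ht.2.1
        rcases Set.mem_uIcc.1 (ubetween s hs.1 t ht.1 η hη) with h | h <;> linarith
      have h2 : θ * S ≤ |u η| := h1.trans (le_abs_self _)
      have ha0 := hc₁.trans_le ha
      rw [h, abs_mul, abs_mul, abs_of_pos ha0]
      gcongr
    have hB2 : volume {x | x ∈ B ∧ u x < -(θ * S) ∧ |g x| ≤ ε * V} ≤
        ENNReal.ofReal (4 * (c₂ / c₁) * θ * r) := by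
      refine (volume_le_of_expanding (F := g) (m := c₁ * (θ * S)) (e := ε * V) (by positivity)
        ?_ (fun s hs => hs.2.2)).trans (ENNReal.ofReal_le_ofReal hbound)
      intro s hs t ht
      obtain ⟨η, hη, a, ha, h⟩ := gslope s hs.1 t ht.1
      have h1 : u η ≤ -(θ * S) := by
        have h2 := hs.2.1
        have h3 := ht.2.1
        rcases Set.mem_uIcc.1 (ubetween s hs.1 t ht.1 η hη) with h | h <;> linarith
      have h2 : θ * S ≤ |u η| := by
        have := neg_le_abs (u η)
        linarith
      have ha0 := hc₁.trans_le ha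
      rw [h, abs_mul, abs_mul, abs_of_pos ha0]
      gcongr
    calc _ ≤ _ := measure_mono hsub
      _ ≤ _ := (measure_union_le _ _).trans (add_le_add le_rfl (measure_union_le _ _))
      _ ≤ _ := add_le_add hA (add_le_add hB1 hB2)
      _ = _ := by
        rw [← ENNReal.ofReal_add (by positivity) (by positivity),
          ← ENNReal.ofReal_add (by positivity) (by positivity)]
        congr 1; ring

/-- The triple `(k, u, g)` lies in the box with half-sides `ε K`, `ε U`, `ε V`. -/
def SmallTriple (K U V ε k u g : ℝ) : Prop :=
  |k| ≤ ε * K ∧ |u| ≤ ε * U ∧ |g| ≤ ε * V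

lemma exists_nearest_large {u g : ℝ → ℝ} {x R M N : ℝ}
    (hu : ContinuousOn u (Metric.closedBall x R)) (hg : ContinuousOn g (Metric.closedBall x R))
    (hux : |u x| < M) (hgx : |g x| < N)
    (h : ∃ y ∈ Metric.closedBall x R, M ≤ |u y| ∨ N ≤ |g y|) :
    ∃ r, 0 < r ∧ r ≤ R ∧ (∃ y ∈ Metric.closedBall x r, M ≤ |u y| ∨ N ≤ |g y|) ∧
      ∀ y ∈ Metric.ball x r, |u y| < M ∧ |g y| < N := by
  set T : Set ℝ := (Metric.closedBall x R ∩ u ⁻¹' {z | M ≤ |z|}) ∪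
    (Metric.closedBall x R ∩ g ⁻¹' {z | N ≤ |z|}) with hT
  have hcl : ∀ M : ℝ, IsClosed {z : ℝ | M ≤ |z|} :=
    fun M => isClosed_le continuous_const continuous_abs
  have hTc : IsCompact T := by
    refine IsCompact.union ?_ ?_
    · exact (isCompact_closedBall x R).of_isClosed_subset
        (hu.preimage_isClosed_of_isClosed Metric.isClosed_closedBall (hcl M))
        Set.inter_subset_left
    · exact (isCompact_closedBall x R).of_isClosed_subset
        (hg.preimage_isClosed_of_isClosed Metric.isClosed_closedBall (hcl N))
        Set.inter_subset_left
  have hTne : T.Nonempty := by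
    obtain ⟨y, hy, h | h⟩ := h
    · exact ⟨y, Or.inl ⟨hy, h⟩⟩
    · exact ⟨y, Or.inr ⟨hy, h⟩⟩
  obtain ⟨y, hyT, hmin⟩ := hTc.exists_isMinOn hTne
    (f := fun y => dist y x) (by fun_prop)
  have hyR : dist y x ≤ R := by
    rcases hyT with h | h <;> exact h.1
  have hybad : M ≤ |u y| ∨ N ≤ |g y| := by
    rcases hyT with h | h
    · exact Or.inl h.2
    · exact Or.inr h.2
  refine ⟨dist y x, ?_, hyR, ⟨y, by simp, hybad⟩, ?_⟩
  · rw [dist_pos]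
    rintro rfl
    rcases hybad with h | h <;> linarith
  · intro y' hy'
    rw [Metric.mem_ball] at hy'
    have hy'R : y' ∈ Metric.closedBall x R := by
      rw [Metric.mem_closedBall]; linarith
    constructor
    · by_contra hc
      have := hmin (show y' ∈ T from Or.inl ⟨hy'R, not_lt.1 hc⟩)
      simp only [Set.mem_ofPred_eq] at this
      linarith
    · by_contra hc
      have := hmin (show y' ∈ T from Or.inr ⟨hy'R, not_lt.1 hc⟩)
      simp only [Set.mem_ofPred_eq] at this
      linarith

/-- Points at which some member of a family is `ε`-small, while all `ρ`-small members are
proportional to each other, form a set of small measure. -/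
lemma volume_le_of_proportional {ι : Type*} (size : ι → ℕ) (hsize : ∀ v, 0 < size v)
    (κ : ι → ℝ) (u g : ι → ℝ → ℝ) {w w' : ℝ → ℝ} {c₁ c₂ : ℝ} (hc₁ : 0 < c₁) (h12 : c₁ ≤ c₂)
    {z R : ℝ} (hR : 0 < R)
    (hu : ∀ v, ∀ x ∈ Metric.closedBall z (2 * R), HasDerivAt (u v) (κ v * w x) x)
    (hg : ∀ v, ∀ x ∈ Metric.closedBall z (2 * R), HasDerivAt (g v) (w' x * u v x) x)
    (hw : ∀ x ∈ Metric.closedBall z (2 * R), w x ∈ Set.Icc c₁ c₂)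
    (hw' : ∀ x ∈ Metric.closedBall z (2 * R), w' x ∈ Set.Icc c₁ c₂)
    {K U V ε ρ θ : ℝ} (hK : 0 < K) (hU : 0 < U) (hV : 0 < V) (hε : 0 < ε) (hρ : 0 < ρ)
    (hθ : 0 < θ) (hθ2 : θ ≤ 1 / 2) (hερ : ε ≤ θ ^ 2 * ρ) {X : Set ℝ}
    (hXB : X ⊆ Metric.closedBall z R)
    (hX : ∀ x ∈ X, ∃ v, SmallTriple K U V ε (κ v) (u v x) (g v x))
    (hnd : ∀ x ∈ X, ∀ v, ∃ y ∈ Metric.closedBall x R, ρ * U ≤ |u v y| ∨ ρ * V ≤ |g v y|)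
    (hpar : ∀ x ∈ X, ∀ v₁ v₂, SmallTriple K U V ρ (κ v₁) (u v₁ x) (g v₁ x) →
      SmallTriple K U V ρ (κ v₂) (u v₂ x) (g v₂ x) → ∃ t : ℝ, (size v₂ : ℝ) = |t| * size v₁ ∧
        κ v₂ = t * κ v₁ ∧ ∀ y, u v₂ y = t * u v₁ y ∧ g v₂ y = t * g v₁ y) :
    volume X ≤ ENNReal.ofReal (192 * (c₂ / c₁) * θ * R) := by
  have hc₂ : 0 < c₂ := hc₁.trans_le h12
  have hερ' : ε < ρ := by
    have : θ ^ 2 ≤ 1 / 2 := by nlinarith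
    nlinarith
  have hmono : ∀ {k u g : ℝ}, SmallTriple K U V ε k u g → SmallTriple K U V ρ k u g := by
    rintro k u g ⟨h1, h2, h3⟩
    refine ⟨h1.trans ?_, h2.trans ?_, h3.trans ?_⟩ <;> gcongr
  have hmin : ∀ x : X, ∃ v, SmallTriple K U V ε (κ v) (u v x) (g v x) ∧
      ∀ v', SmallTriple K U V ε (κ v') (u v' x) (g v' x) → size v ≤ size v' := by
    intro x
    obtain ⟨v, hv, hm⟩ := WellFounded.has_min (measure size).wf
      {v | SmallTriple K U V ε (κ v) (u v x) (g v x)} (hX x x.2)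
    exact ⟨v, hv, fun v' hv' => not_lt.1 (hm v' hv')⟩
  choose v hv hvmin using hmin
  have hball : ∀ x : X, Metric.closedBall (x : ℝ) R ⊆ Metric.closedBall z (2 * R) := by
    intro x
    refine Metric.closedBall_subset_closedBall' ?_
    have := hXB x.2
    rw [Metric.mem_closedBall] at this
    linarith
  have hr : ∀ x : X, ∃ r, 0 < r ∧ r ≤ R ∧
      (∃ y ∈ Metric.closedBall (x : ℝ) r, ρ * U ≤ |u (v x) y| ∨ ρ * V ≤ |g (v x) y|) ∧
      ∀ y ∈ Metric.ball (x : ℝ) r, |u (v x) y| < ρ * U ∧ |g (v x) y| < ρ * V := by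
    intro x
    refine exists_nearest_large
      (fun y hy => (hu _ y (hball x hy)).continuousAt.continuousWithinAt)
      (fun y hy => (hg _ y (hball x hy)).continuousAt.continuousWithinAt) ?_ ?_ (hnd x x.2 (v x))
    · exact (hv x).2.1.trans_lt (by gcongr)
    · exact (hv x).2.2.trans_lt (by gcongr)
  choose r hr0 hrR hrbad hrgood using hr
  obtain ⟨A, -, hdisj, hcov⟩ := Vitali.exists_disjoint_subfamily_covering_enlargement_closedBall
    (Set.univ : Set X) (fun x => (x : ℝ)) (fun x => r x / 6) R
    (fun x _ => by have := hrR x; have := hr0 x; linarith) 5 (by norm_num)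
  have hAc : A.Countable := by
    refine hdisj.countable_of_nonempty_interior fun x _ => ?_
    rw [interior_closedBall _ (by have := hr0 x; positivity)]
    exact Metric.nonempty_ball.2 (by have := hr0 x; positivity)
  have hsub : X ⊆ ⋃ a ∈ A, {y | y ∈ Metric.closedBall (a : ℝ) (r a) ∧
      |u (v a) y| ≤ ε * U ∧ |g (v a) y| ≤ ε * V} := by
    intro x hx
    obtain ⟨a, haA, ha⟩ := hcov ⟨x, hx⟩ (Set.mem_univ _)
    have hxa : x ∈ Metric.closedBall (a : ℝ) (5 * (r a / 6)) :=
      ha (Metric.mem_closedBall_self (by have := hr0 ⟨x, hx⟩; positivity))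
    have hxa' : x ∈ Metric.ball (a : ℝ) (r a) := by
      rw [Metric.mem_closedBall] at hxa
      rw [Metric.mem_ball]
      have := hr0 a
      linarith
    refine Set.mem_biUnion haA ⟨Metric.ball_subset_closedBall hxa', ?_⟩
    have hgood := hrgood a x hxa'
    have hsm := hv ⟨x, hx⟩
    obtain ⟨t, ht1, ht2, ht3⟩ := hpar x hx (v a) (v ⟨x, hx⟩)
      ⟨(hmono (hv a)).1, hgood.1.le, hgood.2.le⟩ (hmono hsm)
    have hsa : (0 : ℝ) < size (v a) := by exact_mod_cast hsize (v a)
    have ht : 1 ≤ |t| := by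
      by_contra hlt
      rw [not_le] at hlt
      have h1 : SmallTriple K U V ε (κ (v ⟨x, hx⟩)) (u (v ⟨x, hx⟩) a) (g (v ⟨x, hx⟩) a) := by
        refine ⟨hsm.1, ?_, ?_⟩
        · rw [(ht3 a).1, abs_mul]
          have := (hv a).2.1
          nlinarith [abs_nonneg (u (v a) a)]
        · rw [(ht3 a).2, abs_mul]
          have := (hv a).2.2
          nlinarith [abs_nonneg (g (v a) a)]
      have h2 : (size (v a) : ℝ) ≤ size (v ⟨x, hx⟩) := by exact_mod_cast hvmin a _ h1
      rw [ht1] at h2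
      nlinarith
    constructor
    · have := hsm.2.1
      simp only [(ht3 x).1, abs_mul] at this
      nlinarith [abs_nonneg (u (v a) x)]
    · have := hsm.2.2
      simp only [(ht3 x).2, abs_mul] at this
      nlinarith [abs_nonneg (g (v a) x)]
  have hone : ∀ a : X, volume {y | y ∈ Metric.closedBall (a : ℝ) (r a) ∧
      |u (v a) y| ≤ ε * U ∧ |g (v a) y| ≤ ε * V} ≤
      ENNReal.ofReal (48 * (c₂ / c₁) * θ) * volume (Metric.closedBall (a : ℝ) (r a / 6)) := by
    intro a
    have hin : Metric.closedBall (a : ℝ) (r a) ⊆ Metric.closedBall z (2 * R) :=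
      (Metric.closedBall_subset_closedBall (hrR a)).trans (hball a)
    obtain ⟨y, hy, hyb⟩ := hrbad a
    refine (volume_both_small_le hc₁ h12 (hr0 a) (fun x hx => hu (v a) x (hin hx))
      (fun x hx => hg (v a) x (hin hx)) (fun x hx => hw x (hin hx)) (fun x hx => hw' x (hin hx))
      hU hV hε hρ hθ hθ2 hερ (hv a).2.1 (hv a).2.2 hy hyb).trans_eq ?_
    rw [Real.volume_closedBall, ← ENNReal.ofReal_mul (by positivity)]
    congr 1; ring
  calc volume X ≤ _ := measure_mono hsub
    _ ≤ ∑' a : A, _ := measure_biUnion_le _ hAc _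
    _ ≤ ∑' a : A, ENNReal.ofReal (48 * (c₂ / c₁) * θ) *
        volume (Metric.closedBall ((a : X) : ℝ) (r a / 6)) :=
      ENNReal.tsum_le_tsum fun a => hone a
    _ = ENNReal.ofReal (48 * (c₂ / c₁) * θ) *
        volume (⋃ a ∈ A, Metric.closedBall ((a : X) : ℝ) (r a / 6)) := by
      rw [ENNReal.tsum_mul_left, measure_biUnion hAc hdisj
        (fun _ _ => Metric.isClosed_closedBall.measurableSet)]
    _ ≤ ENNReal.ofReal (48 * (c₂ / c₁) * θ) * volume (Metric.closedBall z (2 * R)) := by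
      gcongr
      refine Set.iUnion₂_subset fun a _ => ?_
      refine (Metric.closedBall_subset_closedBall ?_).trans (hball a)
      have := hrR a
      have := hr0 a
      linarith
    _ = _ := by
      rw [Real.volume_closedBall, ← ENNReal.ofReal_mul (by positivity)]
      congr 1; ring

/-- `f` has derivatives `f₁`, `f₂` on the ball of radius `2 R` about `z`, and `c₁ ≤ f₂ ≤ c₂`. -/
structure ConvexOnBall (f f₁ f₂ : ℝ → ℝ) (c₁ c₂ z R : ℝ) : Prop where
  c₁_pos : 0 < c₁
  c₁_le : c₁ ≤ 1
  le_c₂ : 1 ≤ c₂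
  R_pos : 0 < R
  deriv_f : ∀ x ∈ Metric.closedBall z (2 * R), HasDerivAt f (f₁ x) x
  deriv_f₁ : ∀ x ∈ Metric.closedBall z (2 * R), HasDerivAt f₁ (f₂ x) x
  bounds : ∀ x ∈ Metric.closedBall z (2 * R), f₂ x ∈ Set.Icc c₁ c₂

/-- Side lengths `Q`, `T`, `δ` of a box of volume one, in the range where the
nondivergence argument applies on balls of radius `R`. -/
structure AdmissibleBox (c₁ R Q T δ : ℝ) : Prop where
  Q_pos : 0 < Q
  T_pos : 0 < T
  δ_pos : 0 < δ
  mul_eq : Q * T * δ = 1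
  T_le : T ≤ 1
  T_le_R : T ≤ R
  δ_le : δ ≤ 1
  Q_ge : 1 ≤ Q
  QR_ge : 1 ≤ Q * R
  QRR_ge : 8 ≤ c₁ * Q * R ^ 2

/-- Points of the ball at which the lattice attached to the curve has a short nonzero vector. -/
def shortVectorSet (f f₁ : ℝ → ℝ) (z R Q T δ ε : ℝ) : Set ℝ :=
  {x | x ∈ Metric.closedBall z R ∧ ∃ v : ℤ × ℤ × ℤ, v ≠ 0 ∧
    SmallTriple Q T δ ε (-(v.1 : ℝ)) (v.2.1 - v.1 * x)
      (v.1 * f x + f₁ x * (v.2.1 - v.1 * x) - v.2.2)}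

/-- Points of the ball at which the dual lattice has a short nonzero vector. -/
def shortDualVectorSet (f f₁ : ℝ → ℝ) (z R Q T δ ε : ℝ) : Set ℝ :=
  {x | x ∈ Metric.closedBall z R ∧ ∃ a : ℤ × ℤ × ℤ, a ≠ 0 ∧
    SmallTriple (Q * T) (Q * δ) (T * δ) ε (a.2.2 : ℝ) (a.2.1 + a.2.2 * f₁ x)
      (a.1 + a.2.1 * x + a.2.2 * f x)}

/-- The cross product of integer vectors. -/
def crossInt (v w : ℤ × ℤ × ℤ) : ℤ × ℤ × ℤ :=
  (v.2.1 * w.2.2 - v.2.2 * w.2.1, v.2.2 * w.1 - v.1 * w.2.2, v.1 * w.2.1 - v.2.1 * w.1)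

/-- The `ℓ¹` size of an integer vector. -/
def sizeInt (v : ℤ × ℤ × ℤ) : ℕ := v.1.natAbs + v.2.1.natAbs + v.2.2.natAbs

lemma sizeInt_cast (v : ℤ × ℤ × ℤ) :
    (sizeInt v : ℝ) = |(v.1 : ℝ)| + |(v.2.1 : ℝ)| + |(v.2.2 : ℝ)| := by
  simp [sizeInt, Nat.cast_natAbs]

lemma sizeInt_pos {v : ℤ × ℤ × ℤ} (hv : v ≠ 0) : 0 < sizeInt v := by
  rcases v with ⟨a, b, c⟩
  simp only [sizeInt, ne_eq, Prod.mk_eq_zero] at *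
  omega

lemma exists_smul_of_crossInt_eq_zero {v w : ℤ × ℤ × ℤ} (hv : v ≠ 0) (h : crossInt v w = 0) :
    ∃ t : ℝ, (w.1 : ℝ) = t * v.1 ∧ (w.2.1 : ℝ) = t * v.2.1 ∧ (w.2.2 : ℝ) = t * v.2.2 := by
  rcases v with ⟨a, b, c⟩
  rcases w with ⟨a', b', c'⟩
  simp only [crossInt, Prod.mk_eq_zero] at h
  obtain ⟨h1, h2, h3⟩ := h
  have h1' : (b : ℝ) * c' - c * b' = 0 := by exact_mod_cast h1
  have h2' : (c : ℝ) * a' - a * c' = 0 := by exact_mod_cast h2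
  have h3' : (a : ℝ) * b' - b * a' = 0 := by exact_mod_cast h3
  by_cases ha : (a : ℝ) = 0
  · by_cases hb : (b : ℝ) = 0
    · by_cases hc : (c : ℝ) = 0
      · exact absurd (by simp_all) hv
      · refine ⟨c' / c, ?_, ?_, ?_⟩ <;> simp only <;> field_simp <;> linarith
    · refine ⟨b' / b, ?_, ?_, ?_⟩ <;> simp only <;> field_simp <;> linarith
  · refine ⟨a' / a, ?_, ?_, ?_⟩ <;> simp only <;> field_simp <;> linarith

lemma abs_det_le {a b a' b' ρ X Y : ℝ} (hρ : 0 ≤ ρ) (hX : 0 ≤ X) (hY : 0 ≤ Y)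
    (ha : |a| ≤ ρ * X) (ha' : |a'| ≤ ρ * X) (hb : |b| ≤ ρ * Y) (hb' : |b'| ≤ ρ * Y) :
    |a * b' - b * a'| ≤ 2 * ρ ^ 2 * (X * Y) := by
  have h1 : |a * b'| ≤ (ρ * X) * (ρ * Y) := by
    rw [abs_mul]; gcongr
  have h2 : |b * a'| ≤ (ρ * Y) * (ρ * X) := by
    rw [abs_mul]; gcongr
  have := abs_sub (a * b') (b * a')
  nlinarith

lemma int_eq_zero_of_abs_lt_one {a : ℤ} (h : |(a : ℝ)| < 1) : a = 0 := by
  have : |a| < 1 := by exact_mod_cast h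
  exact Int.abs_lt_one_iff.1 this

lemma smallTriple_cross {x fx f₁x Q T δ ρ : ℝ} (hQ : 0 < Q) (hT : 0 < T) (hδ : 0 < δ)
    (hρ : 0 < ρ) {v w : ℤ × ℤ × ℤ}
    (hv : SmallTriple Q T δ ρ (-(v.1 : ℝ)) (v.2.1 - v.1 * x)
      (v.1 * fx + f₁x * (v.2.1 - v.1 * x) - v.2.2))
    (hw : SmallTriple Q T δ ρ (-(w.1 : ℝ)) (w.2.1 - w.1 * x)
      (w.1 * fx + f₁x * (w.2.1 - w.1 * x) - w.2.2)) :
    SmallTriple (Q * T) (Q * δ) (T * δ) (2 * ρ ^ 2) ((crossInt v w).2.2 : ℝ)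
      ((crossInt v w).2.1 + (crossInt v w).2.2 * f₁x)
      ((crossInt v w).1 + (crossInt v w).2.1 * x + (crossInt v w).2.2 * fx) := by
  obtain ⟨hv1, hv2, hv3⟩ := hv
  obtain ⟨hw1, hw2, hw3⟩ := hw
  refine ⟨?_, ?_, ?_⟩
  · refine le_of_eq_of_le ?_ (abs_det_le hρ.le hQ.le hT.le hv1 hw1 hv2 hw2)
    rw [← abs_neg]; congr 1; simp only [crossInt]; push_cast; ring
  · refine le_of_eq_of_le ?_ (abs_det_le hρ.le hQ.le hδ.le hv1 hw1 hv3 hw3)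
    rw [← abs_neg]; congr 1; simp only [crossInt]; push_cast; ring
  · refine le_of_eq_of_le ?_ (abs_det_le hρ.le hT.le hδ.le hv2 hw2 hv3 hw3)
    rw [← abs_neg]; congr 1; simp only [crossInt]; push_cast; ring

lemma smallTriple_cross_dual {x fx f₁x Q T δ ρ : ℝ} (hQ : 0 < Q) (hT : 0 < T) (hδ : 0 < δ)
    (hQTδ : Q * T * δ = 1) (hρ : 0 < ρ) {a b : ℤ × ℤ × ℤ}
    (ha : SmallTriple (Q * T) (Q * δ) (T * δ) ρ (a.2.2 : ℝ) (a.2.1 + a.2.2 * f₁x)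
      (a.1 + a.2.1 * x + a.2.2 * fx))
    (hb : SmallTriple (Q * T) (Q * δ) (T * δ) ρ (b.2.2 : ℝ) (b.2.1 + b.2.2 * f₁x)
      (b.1 + b.2.1 * x + b.2.2 * fx)) :
    SmallTriple Q T δ (2 * ρ ^ 2) (-((crossInt a b).1 : ℝ))
      ((crossInt a b).2.1 - (crossInt a b).1 * x)
      ((crossInt a b).1 * fx + f₁x * ((crossInt a b).2.1 - (crossInt a b).1 * x) -
        (crossInt a b).2.2) := by
  obtain ⟨ha1, ha2, ha3⟩ := ha
  obtain ⟨hb1, hb2, hb3⟩ := hb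
  have hQT : 0 ≤ Q * T := by positivity
  have hQδ : 0 ≤ Q * δ := by positivity
  have hTδ : 0 ≤ T * δ := by positivity
  refine ⟨?_, ?_, ?_⟩
  · refine le_of_eq_of_le ?_ ((abs_det_le hρ.le hQT hQδ ha1 hb1 ha2 hb2).trans_eq ?_)
    · congr 1; simp only [crossInt]; push_cast; ring
    · linear_combination 2 * ρ ^ 2 * Q * hQTδ
  · refine le_of_eq_of_le ?_ ((abs_det_le hρ.le hQT hTδ ha1 hb1 ha3 hb3).trans_eq ?_)
    · congr 1; simp only [crossInt]; push_cast; ring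
    · linear_combination 2 * ρ ^ 2 * T * hQTδ
  · refine le_of_eq_of_le ?_ ((abs_det_le hρ.le hQδ hTδ ha2 hb2 ha3 hb3).trans_eq ?_)
    · congr 1; simp only [crossInt]; push_cast; ring
    · linear_combination 2 * ρ ^ 2 * δ * hQTδ

lemma SmallTriple.mono {K U V ε ε' k u g : ℝ} (hK : 0 ≤ K) (hU : 0 ≤ U) (hV : 0 ≤ V)
    (hε : ε ≤ ε') (h : SmallTriple K U V ε k u g) : SmallTriple K U V ε' k u g := by
  obtain ⟨h1, h2, h3⟩ := h
  refine ⟨h1.trans ?_, h2.trans ?_, h3.trans ?_⟩ <;> gcongr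

lemma ConvexOnBall.closedBall_subset {f f₁ f₂ : ℝ → ℝ} {c₁ c₂ z R x : ℝ}
    (_ : ConvexOnBall f f₁ f₂ c₁ c₂ z R) (hx : x ∈ Metric.closedBall z R) :
    Metric.closedBall x R ⊆ Metric.closedBall z (2 * R) := by
  refine Metric.closedBall_subset_closedBall' ?_
  rw [Metric.mem_closedBall] at hx
  linarith

lemma exists_large_primal {f f₁ : ℝ → ℝ} {c₁ R Q T δ ρ x : ℝ} (hR : 0 < R)
    (hb : AdmissibleBox c₁ R Q T δ) (hρ : ρ ≤ 1 / 2) {v : ℤ × ℤ × ℤ} (hv : v ≠ 0) :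
    ∃ y ∈ Metric.closedBall x R, ρ * T ≤ |(v.2.1 : ℝ) - v.1 * y| ∨
      ρ * δ ≤ |v.1 * f y + f₁ y * (v.2.1 - v.1 * y) - v.2.2| := by
  by_contra! hcon
  obtain ⟨hQ, hT, hδ, hm, hT1, hTR, hδ1, -, -, -⟩ := hb
  have hx : x ∈ Metric.closedBall x R := Metric.mem_closedBall_self hR.le
  have hxR : x + R ∈ Metric.closedBall x R := by
    simp [Metric.mem_closedBall, abs_of_pos hR]
  obtain ⟨h1, h2⟩ := hcon x hx
  obtain ⟨h3, -⟩ := hcon _ hxR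
  have hq : v.1 = 0 := by
    refine int_eq_zero_of_abs_lt_one ?_
    have h4 := abs_sub ((v.2.1 : ℝ) - v.1 * x) (v.2.1 - v.1 * (x + R))
    have e : (v.2.1 : ℝ) - v.1 * x - (v.2.1 - v.1 * (x + R)) = v.1 * R := by ring
    rw [e, abs_mul, abs_of_pos hR] at h4
    have h5 : |(v.1 : ℝ)| * R < 1 * R := by nlinarith
    exact lt_of_mul_lt_mul_right h5 hR.le
  rw [hq] at h1 h2
  have hp1 : v.2.1 = 0 := by
    refine int_eq_zero_of_abs_lt_one ?_
    simp only [Int.cast_zero, zero_mul, sub_zero] at h1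
    nlinarith
  rw [hp1] at h2
  have hp2 : v.2.2 = 0 := by
    refine int_eq_zero_of_abs_lt_one ?_
    simp only [Int.cast_zero, zero_mul, sub_zero, mul_zero, zero_add, zero_sub, abs_neg] at h2
    nlinarith
  exact hv (Prod.ext hq (Prod.ext hp1 hp2))

lemma exists_large_dual {f f₁ f₂ : ℝ → ℝ} {c₁ c₂ z R Q T δ ρ x : ℝ}
    (hf : ConvexOnBall f f₁ f₂ c₁ c₂ z R) (hx : x ∈ Metric.closedBall z R)
    (hb : AdmissibleBox c₁ R Q T δ) (hρ : ρ ≤ 1 / 2) {a : ℤ × ℤ × ℤ} (ha : a ≠ 0) :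
    ∃ y ∈ Metric.closedBall x R, ρ * (Q * δ) ≤ |(a.2.1 : ℝ) + a.2.2 * f₁ y| ∨
      ρ * (T * δ) ≤ |a.1 + a.2.1 * y + a.2.2 * f y| := by
  by_contra! hcon
  obtain ⟨hQ, hT, hδ, hm, hT1, hTR, hδ1, hQ1, hQR, hQRR⟩ := hb
  have hR := hf.R_pos
  have hsub := hf.closedBall_subset hx
  have hTδ : 0 < T * δ := by positivity
  have hmem : ∀ s : ℝ, |s| ≤ 1 → x + s * R ∈ Metric.closedBall x R := by
    intro s hs
    rw [Metric.mem_closedBall, Real.dist_eq, add_sub_cancel_left, abs_mul, abs_of_pos hR]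
    nlinarith
  set A : ℝ → ℝ := fun y => a.1 + a.2.1 * y + a.2.2 * f y with hA
  set A' : ℝ → ℝ := fun y => a.2.1 + a.2.2 * f₁ y with hA'
  have hAsm : ∀ y ∈ Metric.closedBall x R, |A y| ≤ 1 / 2 * (T * δ) := fun y hy =>
    (hcon y hy).2.le.trans (by gcongr)
  have dA : ∀ y ∈ Metric.closedBall x R, HasDerivAt A (A' y) y := by
    intro y hy
    have h1 := (((hasDerivAt_id y).const_mul (a.2.1 : ℝ)).const_add (a.1 : ℝ)).add
      ((hf.deriv_f y (hsub hy)).const_mul (a.2.2 : ℝ))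
    exact h1.congr_deriv (by simp [hA'])
  have dA' : ∀ y ∈ Metric.closedBall x R, HasDerivAt A' (a.2.2 * f₂ y) y := fun y hy =>
    ((hf.deriv_f₁ y (hsub hy)).const_mul (a.2.2 : ℝ)).const_add _
  have hslope : ∀ s : ℝ, |s| ≤ 1 → |s + 1 / 2| ≤ 1 →
      ∃ ξ ∈ Set.Icc (x + s * R) (x + (s + 1 / 2) * R), |A' ξ| * (R / 2) ≤ T * δ := by
    intro s hs hs'
    obtain ⟨ξ, hξ, h⟩ := exists_slope_uIcc
      (fun y hy => dA y (uIcc_subset_closedBall (hmem s hs) (hmem _ hs') hy))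
    rw [Set.uIcc_of_le (by nlinarith)] at hξ
    refine ⟨ξ, hξ, ?_⟩
    have h1 := abs_sub (A (x + (s + 1 / 2) * R)) (A (x + s * R))
    have e : x + (s + 1 / 2) * R - (x + s * R) = R / 2 := by ring
    rw [h, e, abs_mul, abs_of_pos (half_pos hR)] at h1
    have h2 := hAsm _ (hmem s hs)
    have h3 := hAsm _ (hmem _ hs')
    linarith
  obtain ⟨ξ₁, hξ₁, h1⟩ := hslope (-1) (by norm_num) (by norm_num)
  obtain ⟨ξ₂, hξ₂, h2⟩ := hslope (1 / 2) (by norm_num) (by norm_num)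
  have hball : ∀ ξ : ℝ, x + -1 * R ≤ ξ → ξ ≤ x + 1 * R → ξ ∈ Metric.closedBall x R := by
    intro ξ h h'
    rw [Real.closedBall_eq_Icc]
    exact ⟨by linarith, by linarith⟩
  have hξ₁' := hball ξ₁ hξ₁.1 (by nlinarith [hξ₁.2])
  have hξ₂' := hball ξ₂ (by nlinarith [hξ₂.1]) (by nlinarith [hξ₂.2])
  obtain ⟨η, hη, h3⟩ := exists_slope_uIcc
    (fun y hy => dA' y (uIcc_subset_closedBall hξ₁' hξ₂' hy))
  have hη' := hf.bounds η (hsub (uIcc_subset_closedBall hξ₁' hξ₂' hη))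
  have hc₁ := hf.c₁_pos
  have hQTδ : Q * (T * δ) = 1 := by linarith
  have ha2 : a.2.2 = 0 := by
    refine int_eq_zero_of_abs_lt_one ?_
    have h4 := abs_sub (A' ξ₂) (A' ξ₁)
    have h5 : R ≤ ξ₂ - ξ₁ := by nlinarith [hξ₁.2, hξ₂.1]
    rw [h3, abs_mul, abs_mul, abs_of_pos (hc₁.trans_le hη'.1),
      abs_of_pos (hR.trans_le h5)] at h4
    have h6 : |(a.2.2 : ℝ)| * c₁ * R ≤ |(a.2.2 : ℝ)| * f₂ η * (ξ₂ - ξ₁) := by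
      have := hη'.1
      have : 0 < f₂ η := hc₁.trans_le hη'.1
      gcongr
    have h7 : |(a.2.2 : ℝ)| * c₁ * R * (R / 2) ≤ 2 * (T * δ) := by
      have : |(a.2.2 : ℝ)| * c₁ * R ≤ |A' ξ₂| + |A' ξ₁| := h6.trans h4
      nlinarith
    have h8 : |(a.2.2 : ℝ)| * (c₁ * Q * R ^ 2) ≤ 4 := by
      have : |(a.2.2 : ℝ)| * (c₁ * Q * R ^ 2) =
        2 * Q * (|(a.2.2 : ℝ)| * c₁ * R * (R / 2)) := by ring
      rw [this]
      nlinarith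
    nlinarith [abs_nonneg (a.2.2 : ℝ)]
  have ha1 : a.2.1 = 0 := by
    refine int_eq_zero_of_abs_lt_one ?_
    simp only [hA', ha2, Int.cast_zero, zero_mul, add_zero] at h1
    have h4 : |(a.2.1 : ℝ)| * (Q * R) ≤ 2 := by nlinarith
    have h5 := hAsm _ (hmem 0 (by norm_num))
    have h6 := hAsm _ (hmem 1 (by norm_num))
    simp only [hA, ha2, Int.cast_zero, zero_mul, add_zero, one_mul] at h5 h6
    have h7 := abs_sub ((a.1 : ℝ) + a.2.1 * (x + R)) (a.1 + a.2.1 * x)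
    have e : (a.1 : ℝ) + a.2.1 * (x + R) - (a.1 + a.2.1 * x) = a.2.1 * R := by ring
    rw [e, abs_mul, abs_of_pos hR] at h7
    have h8 := (hcon _ (hmem 0 (by norm_num))).2
    simp only [ha2, Int.cast_zero, zero_mul, add_zero] at h8
    have h9 : |(a.2.1 : ℝ)| * R < T * δ := by nlinarith
    nlinarith [abs_nonneg (a.2.1 : ℝ)]
  have ha0 : a.1 = 0 := by
    refine int_eq_zero_of_abs_lt_one ?_
    have h5 := hAsm _ (hmem 0 (by norm_num))
    simp only [hA, ha2, ha1, Int.cast_zero, zero_mul, add_zero] at h5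
    nlinarith
  exact ha (Prod.ext ha0 (Prod.ext ha1 ha2))

lemma volume_shortVectorSet_diff_le {f f₁ f₂ : ℝ → ℝ} {c₁ c₂ z R Q T δ ε ε' ρ θ : ℝ}
    (hf : ConvexOnBall f f₁ f₂ c₁ c₂ z R) (hb : AdmissibleBox c₁ R Q T δ)
    (hε : 0 < ε) (hρ : 0 < ρ) (hρ2 : ρ ≤ 1 / 2) (hθ : 0 < θ) (hθ2 : θ ≤ 1 / 2)
    (hερ : ε ≤ θ ^ 2 * ρ) (hε' : 2 * ρ ^ 2 ≤ ε') :
    volume (shortVectorSet f f₁ z R Q T δ ε \ shortDualVectorSet f f₁ z R Q T δ ε') ≤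
      ENNReal.ofReal (192 * (c₂ / c₁) * θ * R) := by
  have hQ := hb.Q_pos
  have hT := hb.T_pos
  have hδ := hb.δ_pos
  refine volume_le_of_proportional (ι := {v : ℤ × ℤ × ℤ // v ≠ 0}) (fun v => sizeInt v)
    (fun v => sizeInt_pos v.2) (fun v => -(v.1.1 : ℝ)) (fun v x => v.1.2.1 - v.1.1 * x)
    (fun v x => v.1.1 * f x + f₁ x * (v.1.2.1 - v.1.1 * x) - v.1.2.2)
    (w := fun _ => 1) (w' := f₂)
    hf.c₁_pos (hf.c₁_le.trans hf.le_c₂) hf.R_pos ?_ ?_ ?_ hf.bounds hQ hT hδ hε hρ hθ hθ2 hερ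
    (fun x hx => hx.1.1) ?_ ?_ ?_
  · intro v x _
    have h1 := ((hasDerivAt_id x).const_mul (v.1.1 : ℝ)).const_sub (v.1.2.1 : ℝ)
    exact h1.congr_deriv (by simp)
  · intro v x hx
    have h1 := ((hasDerivAt_id x).const_mul (v.1.1 : ℝ)).const_sub (v.1.2.1 : ℝ)
    have h2 := (((hf.deriv_f x hx).const_mul (v.1.1 : ℝ)).add
      ((hf.deriv_f₁ x hx).mul h1)).sub_const (v.1.2.2 : ℝ)
    exact h2.congr_deriv (by simp only [id]; ring)
  · exact fun x _ => ⟨hf.c₁_le, hf.le_c₂⟩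
  · rintro x ⟨⟨-, v, hv, hs⟩, -⟩
    exact ⟨⟨v, hv⟩, hs⟩
  · intro x _ v
    exact exists_large_primal hf.R_pos hb hρ2 v.2
  · rintro x ⟨⟨hxB, -⟩, hxD⟩ v₁ v₂ h₁ h₂
    by_cases hc : crossInt v₁.1 v₂.1 = 0
    · obtain ⟨t, e1, e2, e3⟩ := exists_smul_of_crossInt_eq_zero v₁.2 hc
      refine ⟨t, ?_, ?_, fun y => ⟨?_, ?_⟩⟩
      · rw [sizeInt_cast, sizeInt_cast, e1, e2, e3, abs_mul, abs_mul, abs_mul]; ring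
      · rw [e1]; ring
      · rw [e1, e2]; ring
      · rw [e1, e2, e3]; ring
    · exact absurd ⟨hxB, _, hc, (smallTriple_cross hQ hT hδ hρ h₁ h₂).mono (by positivity)
        (by positivity) (by positivity) hε'⟩ hxD

lemma volume_shortDualVectorSet_diff_le {f f₁ f₂ : ℝ → ℝ} {c₁ c₂ z R Q T δ ε ε' ρ θ : ℝ}
    (hf : ConvexOnBall f f₁ f₂ c₁ c₂ z R) (hb : AdmissibleBox c₁ R Q T δ)
    (hε : 0 < ε) (hρ : 0 < ρ) (hρ2 : ρ ≤ 1 / 2) (hθ : 0 < θ) (hθ2 : θ ≤ 1 / 2)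
    (hερ : ε ≤ θ ^ 2 * ρ) (hε' : 2 * ρ ^ 2 ≤ ε') :
    volume (shortDualVectorSet f f₁ z R Q T δ ε \ shortVectorSet f f₁ z R Q T δ ε') ≤
      ENNReal.ofReal (192 * (c₂ / c₁) * θ * R) := by
  have hQ := hb.Q_pos
  have hT := hb.T_pos
  have hδ := hb.δ_pos
  refine volume_le_of_proportional (ι := {v : ℤ × ℤ × ℤ // v ≠ 0}) (fun v => sizeInt v)
    (fun v => sizeInt_pos v.2) (fun v => (v.1.2.2 : ℝ)) (fun v x => v.1.2.1 + v.1.2.2 * f₁ x)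
    (fun v x => v.1.1 + v.1.2.1 * x + v.1.2.2 * f x)
    (w := f₂) (w' := fun _ => 1) (K := Q * T) (U := Q * δ) (V := T * δ)
    hf.c₁_pos (hf.c₁_le.trans hf.le_c₂) hf.R_pos ?_ ?_ hf.bounds ?_ (by positivity)
    (by positivity) (by positivity) hε hρ hθ hθ2 hερ
    (fun x hx => hx.1.1) ?_ ?_ ?_
  · intro v x hx
    exact ((hf.deriv_f₁ x hx).const_mul (v.1.2.2 : ℝ)).const_add _
  · intro v x hx
    have h1 := (((hasDerivAt_id x).const_mul (v.1.2.1 : ℝ)).const_add (v.1.1 : ℝ)).add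
      ((hf.deriv_f x hx).const_mul (v.1.2.2 : ℝ))
    exact h1.congr_deriv (by ring)
  · exact fun x _ => ⟨hf.c₁_le, hf.le_c₂⟩
  · rintro x ⟨⟨-, v, hv, hs⟩, -⟩
    exact ⟨⟨v, hv⟩, hs⟩
  · intro x hx v
    exact exists_large_dual hf hx.1.1 hb hρ2 v.2
  · rintro x ⟨⟨hxB, -⟩, hxD⟩ v₁ v₂ h₁ h₂
    by_cases hc : crossInt v₁.1 v₂.1 = 0
    · obtain ⟨t, e1, e2, e3⟩ := exists_smul_of_crossInt_eq_zero v₁.2 hc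
      refine ⟨t, ?_, ?_, fun y => ⟨?_, ?_⟩⟩
      · rw [sizeInt_cast, sizeInt_cast, e1, e2, e3, abs_mul, abs_mul, abs_mul]; ring
      · exact e3
      · rw [e2, e3]; ring
      · rw [e1, e2, e3]; ring
    · exact absurd ⟨hxB, _, hc, (smallTriple_cross_dual hQ hT hδ hb.mul_eq hρ h₁ h₂).mono hQ.le
        hT.le hδ.le hε'⟩ hxD

lemma shortVectorSet_eq_empty {f f₁ : ℝ → ℝ} {z R Q T δ ε : ℝ} (hQ : ε * Q < 1)
    (hT : ε * T < 1) (hδ : ε * δ < 1) : shortVectorSet f f₁ z R Q T δ ε = ∅ := by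
  refine Set.eq_empty_of_forall_notMem ?_
  rintro x ⟨-, ⟨q, p, r⟩, hv, h1, h2, h3⟩
  simp only at h1 h2 h3
  obtain rfl : q = 0 := int_eq_zero_of_abs_lt_one (by rw [abs_neg] at h1; linarith)
  obtain rfl : p = 0 := int_eq_zero_of_abs_lt_one (by simp at h2; linarith)
  obtain rfl : r = 0 := int_eq_zero_of_abs_lt_one (by simp at h3; linarith)
  exact hv rfl

lemma shortDualVectorSet_eq_empty {f f₁ : ℝ → ℝ} {z R Q T δ ε : ℝ} (hQT : ε * (Q * T) < 1)
    (hQδ : ε * (Q * δ) < 1) (hTδ : ε * (T * δ) < 1) :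
    shortDualVectorSet f f₁ z R Q T δ ε = ∅ := by
  refine Set.eq_empty_of_forall_notMem ?_
  rintro x ⟨-, ⟨p, r, q⟩, hv, h1, h2, h3⟩
  simp only at h1 h2 h3
  obtain rfl : q = 0 := int_eq_zero_of_abs_lt_one (by linarith)
  obtain rfl : r = 0 := int_eq_zero_of_abs_lt_one (by simp at h2; linarith)
  obtain rfl : p = 0 := int_eq_zero_of_abs_lt_one (by simp at h3; linarith)
  exact hv rfl

lemma volume_shortVectorSet_and_dual_le {f f₁ f₂ : ℝ → ℝ} {c₁ c₂ z R Q T δ : ℝ}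
    (hf : ConvexOnBall f f₁ f₂ c₁ c₂ z R) (hb : AdmissibleBox c₁ R Q T δ) (J : ℕ) :
    ∀ t : ℝ, 0 < t → t ≤ 1 / 6 → (t / 2 ^ J) * Q < 1 →
      volume (shortVectorSet f f₁ z R Q T δ (t ^ 4)) ≤
        ENNReal.ofReal (1152 * (c₂ / c₁) * t * R) ∧
      volume (shortDualVectorSet f f₁ z R Q T δ (t ^ 4)) ≤
        ENNReal.ofReal (1152 * (c₂ / c₁) * t * R) := by
  have hQ := hb.Q_pos
  have hT := hb.T_pos
  have hδ := hb.δ_pos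
  have hc₁ := hf.c₁_pos
  have hc₂ : 0 < c₂ := one_pos.trans_le hf.le_c₂
  have hR := hf.R_pos
  induction J with
  | zero =>
    intro t ht ht6 htQ
    rw [pow_zero, div_one] at htQ
    have h4 : t ^ 4 ≤ t := by
      have : t ^ 3 ≤ 1 := pow_le_one₀ ht.le (by linarith)
      calc t ^ 4 = t ^ 3 * t := by ring
        _ ≤ 1 * t := by gcongr
        _ = t := one_mul t
    have h4' : 0 < t ^ 4 := by positivity
    have hT1 := hb.T_le
    have hδ1 := hb.δ_le
    have hQ1 := hb.Q_ge
    have aux : ∀ s : ℝ, 0 < s → s ≤ Q → t ^ 4 * s < 1 := by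
      intro s hs hsQ
      calc t ^ 4 * s ≤ t * Q := by gcongr
        _ < 1 := htQ
    rw [shortVectorSet_eq_empty (aux Q hQ le_rfl) (aux T hT (hT1.trans hQ1))
      (aux δ hδ (hδ1.trans hQ1)), shortDualVectorSet_eq_empty (aux _ (by positivity) ?_)
      (aux _ (by positivity) ?_) (aux _ (by positivity) ?_)]
    · simp
    · nlinarith
    · nlinarith
    · have : T * δ ≤ 1 := by nlinarith
      linarith
  | succ J ih =>
    intro t ht ht6 htQ
    obtain ⟨ih1, ih2⟩ := ih (t / 2) (by positivity) (by linarith) (by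
      rw [div_div, ← pow_succ']; exact htQ)
    have hmain : ENNReal.ofReal (192 * (c₂ / c₁) * (3 * t) * R) +
        ENNReal.ofReal (1152 * (c₂ / c₁) * (t / 2) * R) =
        ENNReal.ofReal (1152 * (c₂ / c₁) * t * R) := by
      rw [← ENNReal.ofReal_add (by positivity) (by positivity)]
      congr 1; ring
    have hρ2 : t ^ 2 / 6 ≤ 1 / 2 := by nlinarith
    have hερ : t ^ 4 ≤ (3 * t) ^ 2 * (t ^ 2 / 6) := by
      have : 0 < t ^ 4 := by positivity
      nlinarith
    have hε' : 2 * (t ^ 2 / 6) ^ 2 ≤ (t / 2) ^ 4 := by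
      have : 0 < t ^ 4 := by positivity
      nlinarith
    rw [← hmain]
    constructor
    · refine (measure_mono (Set.subset_sdiff_union _
        (shortDualVectorSet f f₁ z R Q T δ ((t / 2) ^ 4)))).trans
        ((measure_union_le _ _).trans ?_)
      exact add_le_add (volume_shortVectorSet_diff_le hf hb (by positivity) (by positivity) hρ2
          (by positivity) (by linarith) hερ hε') ih2
    · refine (measure_mono (Set.subset_sdiff_union _
        (shortVectorSet f f₁ z R Q T δ ((t / 2) ^ 4)))).trans
        ((measure_union_le _ _).trans ?_)
      exact add_le_add (volume_shortDualVectorSet_diff_le hf hb (by positivity) (by positivity)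
          hρ2 (by positivity) (by linarith) hερ hε') ih1

/-- The nondivergence estimate: at least half of the ball has no very short lattice vector. -/
lemma volume_shortVectorSet_le {f f₁ f₂ : ℝ → ℝ} {c₁ c₂ z R Q T δ : ℝ}
    (hf : ConvexOnBall f f₁ f₂ c₁ c₂ z R) (hb : AdmissibleBox c₁ R Q T δ) :
    volume (shortVectorSet f f₁ z R Q T δ ((c₁ / (1152 * c₂)) ^ 4)) ≤ ENNReal.ofReal R := by
  have hc₁ := hf.c₁_pos
  have hc₂ : 0 < c₂ := one_pos.trans_le hf.le_c₂
  have hQ := hb.Q_pos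
  set t := c₁ / (1152 * c₂) with ht
  have ht0 : 0 < t := by positivity
  obtain ⟨J, hJ⟩ := pow_unbounded_of_one_lt (t * Q) one_lt_two
  have ht6 : t ≤ 1 / 6 := by
    rw [ht, div_le_iff₀ (by positivity)]
    have := hf.c₁_le
    have := hf.le_c₂
    linarith
  refine (volume_shortVectorSet_and_dual_le hf hb J t ht0 ht6 ?_).1.trans_eq ?_
  · rw [div_mul_eq_mul_div, div_lt_one (by positivity)]; exact hJ
  · congr 1
    rw [ht]; field_simp

lemma abs_sub_lt_of_floor_eq {M : ℕ} {s t : ℝ} (hM : 0 < M)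
    (h : ⌊(M : ℝ) * s⌋ = ⌊(M : ℝ) * t⌋) : |s - t| < 1 / M := by
  have hM' : (0 : ℝ) < M := by exact_mod_cast hM
  have := Int.abs_sub_lt_one_of_floor_eq_floor h
  rw [← mul_sub, abs_mul, abs_of_pos hM'] at this
  rw [lt_div_iff₀ hM']
  linarith

lemma floor_mul_fract_mem {M : ℕ} (hM : 0 < M) (s : ℝ) :
    ⌊(M : ℝ) * Int.fract s⌋ ∈ Finset.Ico (0 : ℤ) M := by
  have hM' : (0 : ℝ) < M := by exact_mod_cast hM
  rw [Finset.mem_Ico]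
  constructor
  · exact Int.floor_nonneg.2 (mul_nonneg hM'.le (Int.fract_nonneg s))
  · rw [Int.floor_lt]
    have := Int.fract_lt_one s
    push_cast
    nlinarith

lemma ceil_one_div_le {s : ℝ} (hs : 0 < s) (hs1 : s ≤ 1) : (⌈1 / s⌉₊ : ℝ) ≤ 2 / s := by
  have h1 : (⌈1 / s⌉₊ : ℝ) < 1 / s + 1 := Nat.ceil_lt_add_one (by positivity)
  have h2 : 1 ≤ 1 / s := by rwa [le_div_iff₀ hs, one_mul]
  have h3 : 2 / s = 1 / s + 1 / s := by ring
  linarith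

/-- Dirichlet's pigeonhole argument adapted to a curve point without short lattice vectors. -/
lemma exists_int_approx {x fx f₁x Q T δ ε : ℝ} (hQ : 0 < Q) (hT : 0 < T) (hδ : 0 < δ)
    (hm : Q * T * δ = 1) (hT1 : T ≤ 1) (hδ1 : δ ≤ 1) (hε : 0 < ε) (hε1 : ε ≤ 1)
    (hns : ∀ v : ℤ × ℤ × ℤ, v ≠ 0 → ¬ SmallTriple Q T δ ε (-(v.1 : ℝ)) (v.2.1 - v.1 * x)
      (v.1 * fx + f₁x * (v.2.1 - v.1 * x) - v.2.2)) :
    ∃ q p₁ p₂ : ℤ, ε * Q < q ∧ q ≤ 4 * Q / ε ^ 2 ∧ |p₁ - q * x| ≤ ε * T ∧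
      |q * fx + f₁x * (p₁ - q * x) - p₂| ≤ ε * δ := by
  have hεT : 0 < ε * T := by positivity
  have hεδ : 0 < ε * δ := by positivity
  set M₁ := ⌈1 / (ε * T)⌉₊ with hM₁
  set M₂ := ⌈1 / (ε * δ)⌉₊ with hM₂
  have hM₁0 : 0 < M₁ := Nat.ceil_pos.2 (by positivity)
  have hM₂0 : 0 < M₂ := Nat.ceil_pos.2 (by positivity)
  have hM₁' : (0 : ℝ) < M₁ := by exact_mod_cast hM₁0
  have hM₂' : (0 : ℝ) < M₂ := by exact_mod_cast hM₂0
  have hd₁ : 1 / (M₁ : ℝ) ≤ ε * T := by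
    rw [div_le_comm₀ hM₁' hεT]; exact Nat.le_ceil _
  have hd₂ : 1 / (M₂ : ℝ) ≤ ε * δ := by
    rw [div_le_comm₀ hM₂' hεδ]; exact Nat.le_ceil _
  have hN : ((M₁ * M₂ : ℕ) : ℝ) ≤ 4 * Q / ε ^ 2 := by
    have h1 := ceil_one_div_le hεT (by nlinarith)
    have h2 := ceil_one_div_le hεδ (by nlinarith)
    push_cast
    calc (M₁ : ℝ) * M₂ ≤ 2 / (ε * T) * (2 / (ε * δ)) := by gcongr
      _ = 4 * (Q * T * δ) / (ε ^ 2 * T * δ) := by rw [hm]; field_simp; norm_num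
      _ = 4 * Q / ε ^ 2 := by field_simp
  set w : ℕ → ℝ := fun q => q * fx + f₁x * (⌊(q : ℝ) * x⌋ - q * x) with hw
  obtain ⟨a, ha, b, hb, hab, heq⟩ := Finset.exists_ne_map_eq_of_card_lt_of_maps_to
    (s := Finset.range (M₁ * M₂ + 1)) (t := Finset.Ico (0 : ℤ) M₁ ×ˢ Finset.Ico (0 : ℤ) M₂)
    (f := fun q => (⌊(M₁ : ℝ) * Int.fract ((q : ℝ) * x)⌋, ⌊(M₂ : ℝ) * Int.fract (w q)⌋))
    (by simp)
    (by
      intro q _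
      exact Finset.mem_product.2 ⟨floor_mul_fract_mem hM₁0 _, floor_mul_fract_mem hM₂0 _⟩)
  wlog hlt : b < a generalizing a b
  · exact this b hb a ha hab.symm heq.symm (lt_of_le_of_ne (not_lt.1 hlt) hab)
  rw [Prod.mk.injEq] at heq
  have h1 := abs_sub_lt_of_floor_eq hM₁0 heq.1
  have h2 := abs_sub_lt_of_floor_eq hM₂0 heq.2
  have hp₁ : |((⌊(a : ℝ) * x⌋ - ⌊(b : ℝ) * x⌋ : ℤ) : ℝ) - ((a : ℤ) - (b : ℤ) : ℤ) * x| ≤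
      ε * T := by
    rw [← abs_neg]
    refine le_trans (le_of_eq ?_) (h1.le.trans hd₁)
    congr 1
    rw [Int.fract, Int.fract]; push_cast; ring
  have hp₂ : |(((a : ℤ) - (b : ℤ) : ℤ) : ℝ) * fx +
      f₁x * ((⌊(a : ℝ) * x⌋ - ⌊(b : ℝ) * x⌋ : ℤ) - ((a : ℤ) - (b : ℤ) : ℤ) * x) -
      ((⌊w a⌋ - ⌊w b⌋ : ℤ) : ℝ)| ≤ ε * δ := by
    refine le_trans (le_of_eq ?_) (h2.le.trans hd₂)
    congr 1
    rw [Int.fract, Int.fract]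
    simp only [hw]
    push_cast; ring
  have hq0 : (0 : ℝ) < ((a : ℤ) - (b : ℤ) : ℤ) := by
    have : (b : ℝ) < a := by exact_mod_cast hlt
    push_cast; linarith
  refine ⟨_, _, _, ?_, ?_, hp₁, hp₂⟩
  · by_contra hle
    rw [not_lt] at hle
    refine hns (((a : ℤ) - (b : ℤ) : ℤ), (⌊(a : ℝ) * x⌋ - ⌊(b : ℝ) * x⌋ : ℤ), ⌊w a⌋ - ⌊w b⌋)
      ?_ ⟨?_, hp₁, hp₂⟩
    · intro h
      have := congrArg Prod.fst h
      simp only [Prod.fst_zero] at this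
      rw [this] at hq0
      simp at hq0
    · rw [abs_neg, abs_of_pos hq0]; exact hle
  · refine le_trans ?_ hN
    have h3 : a ≤ M₁ * M₂ := Nat.lt_succ_iff.1 (Finset.mem_range.1 ha)
    have h4 : (a : ℝ) ≤ ((M₁ * M₂ : ℕ) : ℝ) := by exact_mod_cast h3
    push_cast at h4 ⊢
    have : (0 : ℝ) ≤ b := Nat.cast_nonneg b
    linarith

lemma ConvexOnBall.abs_taylor_le {f f₁ f₂ : ℝ → ℝ} {c₁ c₂ z R x y : ℝ}
    (hf : ConvexOnBall f f₁ f₂ c₁ c₂ z R) (hx : x ∈ Metric.closedBall z (2 * R))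
    (hy : y ∈ Metric.closedBall z (2 * R)) :
    |f y - f x - f₁ x * (y - x)| ≤ c₂ * |y - x| ^ 2 := by
  obtain ⟨ξ, hξ, h1⟩ := exists_slope_uIcc
    (fun s hs => hf.deriv_f s (uIcc_subset_closedBall hx hy hs))
  have hξ' := uIcc_subset_closedBall hx hy hξ
  obtain ⟨η, hη, h2⟩ := exists_slope_uIcc
    (fun s hs => hf.deriv_f₁ s (uIcc_subset_closedBall hx hξ' hs))
  have hb := hf.bounds η (uIcc_subset_closedBall hx hξ' hη)
  have hc₁ := hf.c₁_pos
  have hc₂ : 0 < c₂ := one_pos.trans_le hf.le_c₂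
  have h3 : |ξ - x| ≤ |y - x| := Set.abs_sub_left_of_mem_uIcc hξ
  rw [h1, ← sub_mul, h2, abs_mul, abs_mul, abs_of_pos (hc₁.trans_le hb.1), pow_two, ← mul_assoc]
  have := hb.2
  have : 0 < f₂ η := hc₁.trans_le hb.1
  gcongr

/-- Points `y` in `U` with a denominator of size about `X` for which `(y, f y)` is close to a
rational point with that denominator. -/
def nearRational (f : ℝ → ℝ) (U : Set ℝ) (ε X δ : ℝ) : Set ℝ :=
  {y | y ∈ U ∧ ∃ q p₁ p₂ : ℤ, ε ^ 3 * X / 4 < q ∧ q ≤ X ∧ y = p₁ / q ∧ |q * f y - p₂| ≤ δ / 2}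

lemma volume_near_nearRational_of_box {f f₁ f₂ : ℝ → ℝ} {c₁ c₂ z R Q T δ ε X : ℝ}
    (hf : ConvexOnBall f f₁ f₂ c₁ c₂ z R) (hb : AdmissibleBox c₁ R Q T δ)
    (hT : c₂ * T ≤ 1) (hε : ε = (c₁ / (1152 * c₂)) ^ 4) (hX : Q = ε ^ 2 * X / 4) :
    ENNReal.ofReal R ≤ volume {x | x ∈ Metric.closedBall z R ∧
      ∃ y ∈ nearRational f (Metric.closedBall z (2 * R)) ε X δ, |x - y| ≤ T / Q} := by
  have hQ0 := hb.Q_pos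
  have hT0 := hb.T_pos
  have hδ0 := hb.δ_pos
  have hT1 := hb.T_le
  have hQ1 := hb.Q_ge
  have hTR := hb.T_le_R
  have hc₁ := hf.c₁_pos
  have hc₂ : 0 < c₂ := one_pos.trans_le hf.le_c₂
  have hR := hf.R_pos
  have hε0 : 0 < ε := by rw [hε]; positivity
  have ht : c₁ / (1152 * c₂) ≤ 1 / 4 := by
    rw [div_le_iff₀ (by positivity)]
    have := hf.c₁_le
    have := hf.le_c₂
    linarith
  have hε4 : ε ≤ 1 / 4 := by
    have h0 : 0 < c₁ / (1152 * c₂) := by positivity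
    rw [hε]
    calc (c₁ / (1152 * c₂)) ^ 4 ≤ (1 / 4) ^ 4 := by gcongr
      _ ≤ 1 / 4 := by norm_num
  set S := {x | x ∈ Metric.closedBall z R ∧
      ∃ y ∈ nearRational f (Metric.closedBall z (2 * R)) ε X δ, |x - y| ≤ T / Q}
  have hsub : Metric.closedBall z R ⊆ shortVectorSet f f₁ z R Q T δ ε ∪ S := by
    intro x hx
    by_cases hxs : x ∈ shortVectorSet f f₁ z R Q T δ ε
    · exact Or.inl hxs
    · refine Or.inr ⟨hx, ?_⟩
      obtain ⟨q, p₁, p₂, hq1, hq2, hp1, hp2⟩ := exists_int_approx (fx := f x) (f₁x := f₁ x) hQ0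
        hT0 hδ0 hb.mul_eq hT1 hb.δ_le hε0 (by linarith)
        (fun v hv hs => hxs ⟨hx, v, hv, hs⟩)
      have hq0 : (0 : ℝ) < q := lt_trans (by positivity) hq1
      have hxy : |x - p₁ / q| = |p₁ - q * x| / q := by
        rw [← abs_of_pos hq0, ← abs_div, abs_sub_comm, abs_of_pos hq0]
        congr 1; field_simp
      have hxy1 : |x - p₁ / q| ≤ ε * T / q := by rw [hxy]; gcongr
      have hxy2 : |x - p₁ / q| ≤ T / Q := by
        refine hxy1.trans ?_
        rw [div_le_div_iff₀ hq0 hQ0]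
        nlinarith
      have hyB : (p₁ / q : ℝ) ∈ Metric.closedBall z (2 * R) := by
        rw [Metric.mem_closedBall] at hx ⊢
        have h1 := dist_triangle (p₁ / q : ℝ) x z
        rw [dist_comm _ x, Real.dist_eq x] at h1
        have h2 : T / Q ≤ T := div_le_self hT0.le hQ1
        linarith
      have hxB : x ∈ Metric.closedBall z (2 * R) :=
        Metric.closedBall_subset_closedBall (by linarith) hx
      refine ⟨p₁ / q, ⟨hyB, q, p₁, p₂, ?_, ?_, rfl, ?_⟩, hxy2⟩
      · rw [hX] at hq1
        linarith
      · refine hq2.trans_eq ?_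
        rw [hX]; field_simp
      · have hty := hf.abs_taylor_le hxB hyB
        have e : (q : ℝ) * f (p₁ / q) - p₂ =
            q * (f (p₁ / q) - f x - f₁ x * (p₁ / q - x)) +
            (q * f x + f₁ x * (p₁ - q * x) - p₂) := by
          field_simp; ring
        have hmain : q * |f (p₁ / q) - f x - f₁ x * (p₁ / q - x)| ≤ ε * δ := by
          rw [abs_sub_comm] at hxy1
          calc (q : ℝ) * |f (p₁ / q) - f x - f₁ x * (p₁ / q - x)|
              ≤ q * (c₂ * (ε * T / q) ^ 2) := by
                refine mul_le_mul_of_nonneg_left (hty.trans ?_) hq0.le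
                gcongr
            _ = c₂ * (ε * T) ^ 2 / q := by field_simp
            _ ≤ c₂ * (ε * T) ^ 2 / (ε * Q) := by gcongr
            _ = c₂ * T * T ^ 2 * (ε * δ) / (Q * T * δ) := by field_simp
            _ ≤ ε * δ := by
              rw [hb.mul_eq, div_one]
              have h1 : c₂ * T * T ^ 2 ≤ 1 := by
                have : T ^ 2 ≤ 1 := pow_le_one₀ hT0.le hT1
                have : 0 < c₂ * T := by positivity
                nlinarith
              have : 0 < ε * δ := by positivity
              nlinarith
        rw [e]
        refine (abs_add_le _ _).trans ?_
        rw [abs_mul, abs_of_pos hq0]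
        nlinarith
  have hvs := volume_shortVectorSet_le hf hb
  rw [← hε] at hvs
  have h := (measure_mono (μ := volume) hsub).trans (measure_union_le _ _)
  rw [Real.volume_closedBall, two_mul, ENNReal.ofReal_add hR.le hR.le] at h
  exact (ENNReal.add_le_add_iff_left ENNReal.ofReal_ne_top).1 (h.trans (add_le_add hvs le_rfl))

lemma exists_volume_near_nearRational {f f₁ f₂ : ℝ → ℝ} {c₁ c₂ z R : ℝ}
    (hf : ConvexOnBall f f₁ f₂ c₁ c₂ z R) {ε : ℝ} (hε : ε = (c₁ / (1152 * c₂)) ^ 4) :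
    ∃ Λ : ℝ, ∀ X δ : ℝ, 0 < δ → δ ≤ 1 → Λ ≤ δ * X →
      ENNReal.ofReal R ≤ volume {x | x ∈ Metric.closedBall z R ∧
        ∃ y ∈ nearRational f (Metric.closedBall z (2 * R)) ε X δ,
          |x - y| ≤ 16 / (ε ^ 4 * X ^ 2 * δ)} := by
  have hc₁ := hf.c₁_pos
  have hc₂ : 0 < c₂ := one_pos.trans_le hf.le_c₂
  have hR := hf.R_pos
  have hε0 : 0 < ε := by rw [hε]; positivity
  refine ⟨4 * c₂ / ε ^ 2 + 4 / (ε ^ 2 * R) + 32 / (ε ^ 2 * c₁ * R ^ 2), ?_⟩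
  intro X δ hδ hδ1 hΛ
  have h0 : 0 < 4 * c₂ / ε ^ 2 := by positivity
  have h0' : 0 < 4 / (ε ^ 2 * R) := by positivity
  have h0'' : 0 < 32 / (ε ^ 2 * c₁ * R ^ 2) := by positivity
  have hX : 0 < X := pos_of_mul_pos_right (lt_of_lt_of_le (by positivity) hΛ) hδ.le
  have hδX : δ * X ≤ X := by nlinarith
  have h1 : 4 * c₂ / ε ^ 2 ≤ δ * X := by linarith
  have h2 : 4 / (ε ^ 2 * R) ≤ δ * X := by linarith
  have h3 : 32 / (ε ^ 2 * c₁ * R ^ 2) ≤ δ * X := by linarith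
  rw [div_le_iff₀ (by positivity)] at h1 h2 h3
  have hεX : ε ^ 2 * (δ * X) ≤ ε ^ 2 * X := by gcongr
  have hP : 0 < ε ^ 2 * X := by positivity
  have hTe : 1 / (ε ^ 2 * X / 4 * δ) = 4 / (δ * X * ε ^ 2) := by field_simp
  have hden : 0 < δ * X * ε ^ 2 := by positivity
  have hcT : c₂ * (1 / (ε ^ 2 * X / 4 * δ)) ≤ 1 := by
    rw [hTe, mul_div_assoc', div_le_one hden]; linarith
  have hT0 : 0 < 1 / (ε ^ 2 * X / 4 * δ) := by positivity
  have h := volume_near_nearRational_of_box (T := 1 / (ε ^ 2 * X / 4 * δ)) (δ := δ) (X := X) hf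
    ⟨by positivity, hT0, hδ, by field_simp, ?_, ?_, hδ1, ?_, ?_, ?_⟩ hcT hε rfl
  · have e : 1 / (ε ^ 2 * X / 4 * δ) / (ε ^ 2 * X / 4) = 16 / (ε ^ 4 * X ^ 2 * δ) := by
      field_simp; norm_num
    rwa [e] at h
  · have := hf.le_c₂
    nlinarith
  · rw [hTe, div_le_iff₀ hden]; linarith
  · have := hf.le_c₂
    nlinarith
  · nlinarith
  · have e : c₁ * (ε ^ 2 * X / 4) * R ^ 2 = (ε ^ 2 * X) * (c₁ * R ^ 2) / 4 := by ring
    have : 0 < c₁ * R ^ 2 := by positivity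
    rw [e]; nlinarith

lemma card_le_of_separated {X : Finset ℝ} {d a ℓ : ℝ} (hd : 0 < d) (hℓ : 0 ≤ ℓ)
    (hX : ∀ s ∈ X, ∀ t ∈ X, s ≠ t → d ≤ |s - t|) (hin : ∀ s ∈ X, s ∈ Set.Icc a (a + ℓ)) :
    (X.card : ℝ) ≤ 1 + ℓ / d := by
  have h1 : X.card ≤ (Finset.range (⌊ℓ / d⌋₊ + 1)).card := by
    refine Finset.card_le_card_of_injOn (fun s => ⌊(s - a) / d⌋₊) ?_ ?_
    · intro s hs
      have := hin s hs
      rw [Finset.mem_coe, Finset.mem_range, Nat.lt_succ_iff]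
      refine Nat.floor_le_floor ?_
      have := this.2
      gcongr
      linarith
    · intro s hs t ht hst
      by_contra hne
      have h2 := hX s hs t ht hne
      have hs' : 0 ≤ (s - a) / d := div_nonneg (by linarith [(hin s hs).1]) hd.le
      have ht' : 0 ≤ (t - a) / d := div_nonneg (by linarith [(hin t ht).1]) hd.le
      have hs1 := Nat.floor_le hs'
      have hs2 := Nat.lt_floor_add_one ((s - a) / d)
      have ht1 := Nat.floor_le ht'
      have ht2 := Nat.lt_floor_add_one ((t - a) / d)
      simp only at hst
      rw [hst] at hs1 hs2
      have h3 : |(s - a) / d - (t - a) / d| < 1 := by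
        rw [abs_lt]; constructor <;> linarith
      rw [← sub_div, abs_div, abs_of_pos hd, div_lt_one hd] at h3
      have e : s - a - (t - a) = s - t := by ring
      rw [e] at h3
      linarith
  rw [Finset.card_range] at h1
  have h2 : ((⌊ℓ / d⌋₊ + 1 : ℕ) : ℝ) ≤ ℓ / d + 1 := by
    push_cast
    have := Nat.floor_le (div_nonneg hℓ hd.le)
    linarith
  have h3 : (X.card : ℝ) ≤ ((⌊ℓ / d⌋₊ + 1 : ℕ) : ℝ) := by exact_mod_cast h1
  linarith

lemma exists_maximal_separated {A : Set ℝ} {d a ℓ : ℝ} (hd : 0 < d) (hℓ : 0 ≤ ℓ)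
    (hA : A ⊆ Set.Icc a (a + ℓ)) :
    ∃ X : Finset ℝ, (X : Set ℝ) ⊆ A ∧ (∀ s ∈ X, ∀ t ∈ X, s ≠ t → d ≤ |s - t|) ∧
      ∀ y ∈ A, ∃ p ∈ X, |y - p| < d := by
  set C : Set ℕ := {m | ∃ X : Finset ℝ, (X : Set ℝ) ⊆ A ∧
    (∀ s ∈ X, ∀ t ∈ X, s ≠ t → d ≤ |s - t|) ∧ X.card = m}
  have hne : C.Nonempty := ⟨0, ∅, by simp, by simp, rfl⟩
  have hbdd : BddAbove C := by
    refine ⟨⌊1 + ℓ / d⌋₊, ?_⟩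
    rintro m ⟨X, hXA, hX, rfl⟩
    exact Nat.le_floor (card_le_of_separated hd hℓ hX fun s hs => hA (hXA hs))
  obtain ⟨X, hXA, hX, hcard⟩ := Nat.sSup_mem hne hbdd
  refine ⟨X, hXA, hX, fun y hy => ?_⟩
  by_contra! hcon
  have hyX : y ∉ X := fun h => by
    have := hcon y h
    rw [sub_self, abs_zero] at this
    linarith
  have : (insert y X).card ∈ C := by
    refine ⟨insert y X, ?_, ?_, rfl⟩
    · rw [Finset.coe_insert]
      exact Set.insert_subset hy hXA
    · intro s hs t ht hst
      rw [Finset.mem_insert] at hs ht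
      rcases hs with rfl | hs <;> rcases ht with rfl | ht
      · exact absurd rfl hst
      · exact hcon t ht
      · rw [abs_sub_comm]; exact hcon s hs
      · exact hX s hs t ht hst
  have h1 := le_csSup hbdd this
  rw [Finset.card_insert_of_notMem hyX, hcard] at h1
  omega

/-- A nonsummable nonnegative sequence, truncated at height `L`, has a window of total mass
comparable to `L` arbitrarily far out. -/
lemma exists_window {g : ℕ → ℝ} (hg : ∀ n, 0 ≤ g n) (hns : ¬ Summable g) {L : ℝ} (hL : 0 < L)
    (n₁ : ℕ) :
    ∃ F : Finset ℕ, (∀ n ∈ F, n₁ ≤ n ∧ 0 < g n) ∧ L ≤ ∑ n ∈ F, min (g n) L ∧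
      ∑ n ∈ F, min (g n) L ≤ 2 * L := by
  suffices h : ∃ F : Finset ℕ, (∀ n ∈ F, n₁ ≤ n) ∧ L ≤ ∑ n ∈ F, min (g n) L ∧
      ∑ n ∈ F, min (g n) L ≤ 2 * L by
    obtain ⟨F, hF, h1, h2⟩ := h
    have e : ∑ n ∈ F with 0 < g n, min (g n) L = ∑ n ∈ F, min (g n) L := by
      rw [Finset.sum_filter]
      refine Finset.sum_congr rfl fun n _ => ?_
      split_ifs with h
      · rfl
      · rw [le_antisymm (not_lt.1 h) (hg n), min_eq_left hL.le]
    refine ⟨F.filter (0 < g ·), fun n hn => ?_, ?_, ?_⟩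
    · rw [Finset.mem_filter] at hn
      exact ⟨hF n hn.1, hn.2⟩
    · rwa [e]
    · rwa [e]
  by_cases hbig : ∃ n, n₁ ≤ n ∧ L ≤ g n
  · obtain ⟨n, hn, hgn⟩ := hbig
    refine ⟨{n}, by simpa using hn, ?_, ?_⟩ <;> rw [Finset.sum_singleton, min_eq_right hgn]
    linarith
  · push Not at hbig
    have hns' : ¬ Summable fun n => g (n + n₁) := fun h => hns ((summable_nat_add_iff n₁).1 h)
    have hex : ∃ m, L ≤ ∑ n ∈ Finset.range m, g (n + n₁) := by
      by_contra! hcon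
      exact hns' (summable_of_sum_range_le (fun n => hg _) fun m => (hcon m).le)
    classical
    have hm := Nat.find_spec hex
    have hmin := fun k hk => Nat.find_min hex (m := k) hk
    set m := Nat.find hex
    have hmpos : m ≠ 0 := by
      intro h0
      rw [h0] at hm
      simp at hm
      linarith
    obtain ⟨k, hk⟩ := Nat.exists_eq_succ_of_ne_zero hmpos
    have h1 := hmin k (by omega)
    have hsum : ∑ n ∈ (Finset.range m).map (addRightEmbedding n₁), min (g n) L =
        ∑ n ∈ Finset.range m, g (n + n₁) := by
      rw [Finset.sum_map]
      exact Finset.sum_congr rfl fun n _ => min_eq_left (hbig _ (Nat.le_add_left _ _)).le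
    refine ⟨(Finset.range m).map (addRightEmbedding n₁), ?_, ?_, ?_⟩
    · intro n hn
      rw [Finset.mem_map] at hn
      obtain ⟨j, -, rfl⟩ := hn
      exact Nat.le_add_left _ _
    · rw [hsum]; exact hm
    · rw [hsum, hk, Finset.sum_range_succ]
      have := hbig (k + n₁) (Nat.le_add_left _ _)
      linarith

/-- The sum of an eventually geometrically decreasing sequence over indices where it is at most
`y`. -/
lemma sum_le_of_geometric {g : ℕ → ℝ} {lam y : ℝ} {n₁ : ℕ} (h0 : 0 ≤ lam) (h1 : lam < 1)
    (hy : 0 ≤ y) (hgrow : ∀ n, n₁ ≤ n → g (n + 1) ≤ lam * g n) {F : Finset ℕ}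
    (hF : ∀ n ∈ F, n₁ ≤ n) (hFy : ∀ n ∈ F, g n ≤ y) :
    ∑ n ∈ F, g n ≤ 1 / (1 - lam) * y := by
  rcases F.eq_empty_or_nonempty with rfl | hne
  · rw [Finset.sum_empty]
    have : 0 < 1 - lam := by linarith
    positivity
  · set m := F.min' hne with hm
    have hmF : m ∈ F := F.min'_mem hne
    have hpow : ∀ j, g (m + j) ≤ lam ^ j * y := by
      intro j
      induction j with
      | zero => simpa using hFy m hmF
      | succ j ih =>
        rw [← add_assoc, pow_succ', mul_assoc]
        exact (hgrow _ ((hF m hmF).trans (Nat.le_add_right _ _))).trans (by gcongr)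
    have hgeo := hasSum_geometric_of_lt_one h0 h1
    calc ∑ n ∈ F, g n ≤ ∑ n ∈ F, lam ^ (n - m) * y := by
          refine Finset.sum_le_sum fun n hn => ?_
          have h2 : m ≤ n := F.min'_le n hn
          have h3 := hpow (n - m)
          rwa [Nat.add_sub_cancel' h2] at h3
      _ = (∑ j ∈ F.image (· - m), lam ^ j) * y := by
          rw [Finset.sum_image, Finset.sum_mul]
          intro a ha b hb hab
          have h2 : m ≤ a := F.min'_le a ha
          have h3 : m ≤ b := F.min'_le b hb
          simp only at hab
          omega
      _ ≤ 1 / (1 - lam) * y := by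
          rw [one_div, ← hgeo.tsum_eq]
          gcongr
          exact hgeo.summable.sum_le_tsum _ fun j _ => by positivity

lemma le_card_mul_of_volume {A : Set ℝ} {X : Finset ℝ} {z R s d : ℝ} (hd : 0 ≤ d) (hsd : s ≤ d)
    (hX : ∀ y ∈ A, y ∈ Metric.closedBall z (R + s) → ∃ p ∈ X, |y - p| < d)
    (hvol : ENNReal.ofReal R ≤
      volume {x | x ∈ Metric.closedBall z R ∧ ∃ y ∈ A, |x - y| ≤ s}) :
    R ≤ X.card * (4 * d) := by
  have hsub : {x | x ∈ Metric.closedBall z R ∧ ∃ y ∈ A, |x - y| ≤ s} ⊆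
      ⋃ p ∈ X, Metric.closedBall p (2 * d) := by
    rintro x ⟨hx, y, hy, hxy⟩
    have hyB : y ∈ Metric.closedBall z (R + s) := by
      rw [Metric.mem_closedBall] at *
      have := dist_triangle y x z
      rw [dist_comm y x, Real.dist_eq x y] at this
      linarith
    obtain ⟨p, hp, hyp⟩ := hX y hy hyB
    refine Set.mem_biUnion hp ?_
    rw [Metric.mem_closedBall, Real.dist_eq]
    have := abs_sub_le x y p
    linarith
  have h1 : ENNReal.ofReal R ≤ ENNReal.ofReal (X.card * (4 * d)) := by
    refine hvol.trans ((measure_mono hsub).trans ((measure_biUnion_finset_le _ _).trans_eq ?_))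
    simp only [Real.volume_closedBall, Finset.sum_const, nsmul_eq_mul]
    rw [ENNReal.ofReal_mul (Nat.cast_nonneg _), ENNReal.ofReal_natCast]
    congr 2; ring
  exact (ENNReal.ofReal_le_ofReal_iff (by positivity)).1 h1

/-- The total `h`-volume of those intervals `[x k - a k, x k + a k]` which meet
`[z - s, z + s]`. -/
noncomputable def hitSum (h : ℝ → ℝ) (x a : ℕ → ℝ) (z s : ℝ) : ℝ :=
  ∑' k, {k | |x k - z| ≤ a k + s}.indicator (fun k => h (a k)) k

/-- A ubiquitous system of points `P n` in an open set `U` of the line: along the levels in `N`,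
the `ρ n`-neighbourhood of `P n` fills half of each ball, while the `h`-volumes of the radii
`r n` decay geometrically and the ubiquity sum diverges. -/
structure UbiquitousSystem (h : ℝ → ℝ) (U : Set ℝ) (N : Set ℕ) (P : ℕ → Set ℝ) (r ρ : ℕ → ℝ)
    (lam : ℝ) : Prop where
  h_pos : ∀ s, 0 < s → 0 < h s
  h_mono : MonotoneOn h (Set.Ioi 0)
  h_zero : Tendsto h (nhdsWithin 0 (Set.Ioi 0)) (nhds 0)
  h_anti : AntitoneOn (fun s => h s / s) (Set.Ioi 0)
  h_inf : Tendsto (fun s => h s / s) (nhdsWithin 0 (Set.Ioi 0)) atTop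
  lam_nonneg : 0 ≤ lam
  lam_lt : lam < 1
  r_pos : ∀ n, 0 < r n
  ρ_pos : ∀ n, 0 < ρ n
  r_tendsto : Tendsto r atTop (nhds 0)
  growth : ∀ᶠ n in atTop, h (r (n + 1)) ≤ lam * h (r n)
  ρ_small : ∀ a, 0 < a → ∀ᶠ n in atTop, n ∈ N → ρ n ≤ a
  ubiquity : ∀ z R, 0 < R → Metric.closedBall z (2 * R) ⊆ U → ∀ᶠ n in atTop, n ∈ N →
    ENNReal.ofReal R ≤ volume {x | x ∈ Metric.closedBall z R ∧ ∃ y ∈ P n, |x - y| ≤ ρ n}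
  divergent : ¬ Summable (N.indicator fun n => h (r n) / ρ n)

namespace UbiquitousSystem

variable {h : ℝ → ℝ} {U : Set ℝ} {N : Set ℕ} {P : ℕ → Set ℝ} {r ρ : ℕ → ℝ} {lam : ℝ}

lemma r_tendsto' (S : UbiquitousSystem h U N P r ρ lam) :
    Tendsto r atTop (nhdsWithin 0 (Set.Ioi 0)) :=
  tendsto_nhdsWithin_iff.2 ⟨S.r_tendsto, Eventually.of_forall S.r_pos⟩

lemma exists_family (S : UbiquitousSystem h U N P r ρ lam) {z R : ℝ} (hR : 0 < R)
    (hU : Metric.closedBall z (2 * R) ⊆ U) {L : ℝ} (hL : 0 < L) (n₀ : ℕ) :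
    ∃ V : Finset (Σ _ : ℕ, ℝ), (∀ i ∈ V, n₀ ≤ i.1 ∧ i.2 ∈ P i.1 ∧ |i.2 - z| + r i.1 ≤ 2 * R ∧
      L * r i.1 ≤ h (r i.1)) ∧ L * R / 4 ≤ ∑ i ∈ V, h (r i.1) ∧
      ∀ x a, 0 < a → ∑ i ∈ V with r i.1 ≤ a ∧ |x - i.2| ≤ a + r i.1, h (r i.1) ≤
        1 / (1 - lam) * h a + 8 * a * L := by
  have hlim := S.r_tendsto'
  have e1 : ∀ᶠ n in atTop, r n < R / 2 := S.r_tendsto.eventually (gt_mem_nhds (half_pos hR))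
  have e2 : ∀ᶠ n in atTop, L ≤ h (r n) / r n :=
    (S.h_inf.comp hlim).eventually (eventually_ge_atTop L)
  have hall := (((e1.and e2).and (S.growth.and (S.ρ_small (R / 2) (half_pos hR)))).and
    (S.ubiquity z R hR hU)).and (eventually_ge_atTop n₀)
  obtain ⟨n₁, hn₁⟩ := eventually_atTop.1 hall
  have hg0 : ∀ n, 0 ≤ N.indicator (fun n => h (r n) / ρ n) n := fun n =>
    Set.indicator_nonneg (fun n _ => (div_pos (S.h_pos _ (S.r_pos n)) (S.ρ_pos n)).le) n
  obtain ⟨F, hF, hFL, hFL2⟩ := exists_window hg0 S.divergent hL n₁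
  have hFN : ∀ n ∈ F, n ∈ N := fun n hn => by
    by_contra hnN
    have := (hF n hn).2
    rw [Set.indicator_of_notMem hnN] at this
    exact lt_irrefl _ this
  set d : ℕ → ℝ := fun n => max (ρ n) (h (r n) / L) with hd
  have hd0 : ∀ n, 0 < d n := fun n => lt_max_of_lt_left (S.ρ_pos n)
  have hmin : ∀ n ∈ F, min (N.indicator (fun n => h (r n) / ρ n) n) L = h (r n) / d n := by
    intro n hn
    have h0 := S.h_pos _ (S.r_pos n)
    have hρ := S.ρ_pos n
    rw [Set.indicator_of_mem (hFN n hn)]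
    simp only [hd]
    rcases le_total (ρ n) (h (r n) / L) with hle | hle
    · rw [max_eq_right hle, min_eq_right, div_div_cancel₀ h0.ne']
      rw [le_div_iff₀ hL] at hle
      rw [le_div_iff₀ hρ]
      linarith
    · rw [max_eq_left hle, min_eq_left]
      rw [div_le_iff₀ hL] at hle
      rw [div_le_iff₀ hρ]
      linarith
  rw [Finset.sum_congr rfl hmin] at hFL hFL2
  have hX : ∀ n, ∃ X : Finset ℝ, (X : Set ℝ) ⊆ P n ∩ Metric.closedBall z (R + ρ n) ∧
      (∀ s ∈ X, ∀ t ∈ X, s ≠ t → d n ≤ |s - t|) ∧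
      ∀ y ∈ P n ∩ Metric.closedBall z (R + ρ n), ∃ p ∈ X, |y - p| < d n := by
    intro n
    have hρ := S.ρ_pos n
    refine exists_maximal_separated (a := z - (R + ρ n)) (ℓ := 2 * (R + ρ n)) (hd0 n)
      (by positivity) ?_
    rw [Real.closedBall_eq_Icc]
    intro y hy
    exact ⟨hy.2.1, by linarith [hy.2.2]⟩
  choose X hXP hXsep hXmax using hX
  refine ⟨F.sigma X, ?_, ?_, ?_⟩
  · rintro ⟨n, p⟩ hi
    rw [Finset.mem_sigma] at hi
    obtain ⟨⟨⟨⟨hr, hLr⟩, -, hρ⟩, -⟩, hn0⟩ := hn₁ n (hF n hi.1).1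
    obtain ⟨hpP, hpB⟩ := hXP n hi.2
    refine ⟨hn0, hpP, ?_, ?_⟩
    · rw [Metric.mem_closedBall, Real.dist_eq] at hpB
      have := hρ (hFN n hi.1)
      simp only
      linarith
    · exact (le_div_iff₀ (S.r_pos n)).1 hLr
  · rw [Finset.sum_sigma]
    calc L * R / 4 ≤ (∑ n ∈ F, h (r n) / d n) * R / 4 := by gcongr
      _ = ∑ n ∈ F, h (r n) / d n * R / 4 := by rw [Finset.sum_mul, Finset.sum_div]
      _ ≤ _ := by
        refine Finset.sum_le_sum fun n hn => ?_
        obtain ⟨⟨-, hub⟩, -⟩ := hn₁ n (hF n hn).1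
        have h1 := le_card_mul_of_volume (X := X n) (hd0 n).le (le_max_left _ _)
          (fun y hy hyB => hXmax n y ⟨hy, hyB⟩) (hub (hFN n hn))
        simp only [Finset.sum_const, nsmul_eq_mul]
        have h0 := S.h_pos _ (S.r_pos n)
        have hdn := hd0 n
        have e : h (r n) / d n * R / 4 = h (r n) * (R / (4 * d n)) := by
          field_simp
        rw [e, mul_comm]
        gcongr
        rw [div_le_iff₀ (by positivity)]
        exact h1
  · intro x a ha
    have hha := S.h_pos a ha
    rw [Finset.sum_filter, Finset.sum_sigma]
    have hlev : ∀ n ∈ F, ∑ p ∈ X n, (if r n ≤ a ∧ |x - p| ≤ a + r n then h (r n) else 0) ≤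
        (if r n ≤ a then h (r n) else 0) + 4 * a * (h (r n) / d n) := by
      intro n hn
      have h0 := S.h_pos _ (S.r_pos n)
      have hdn := hd0 n
      by_cases hra : r n ≤ a
      · simp only [hra, true_and, if_true]
        rw [← Finset.sum_filter, Finset.sum_const, nsmul_eq_mul]
        have hcard := card_le_of_separated (X := (X n).filter fun p => |x - p| ≤ a + r n)
          (a := x - 2 * a) (ℓ := 4 * a) hdn (by positivity)
          (fun s hs t ht => hXsep n s (Finset.mem_filter.1 hs).1 t (Finset.mem_filter.1 ht).1)
          (fun s hs => by
            have := (Finset.mem_filter.1 hs).2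
            rw [abs_le] at this
            constructor <;> linarith)
        calc _ ≤ (1 + 4 * a / d n) * h (r n) := by gcongr
          _ = _ := by ring
      · simp only [hra, false_and, if_false, Finset.sum_const_zero, zero_add]
        positivity
    refine (Finset.sum_le_sum hlev).trans ?_
    rw [Finset.sum_add_distrib, ← Finset.sum_filter, ← Finset.mul_sum]
    have h1 := sum_le_of_geometric (g := fun n => h (r n)) (n₁ := n₁)
      (F := F.filter fun n => r n ≤ a) S.lam_nonneg S.lam_lt hha.le
      (fun n hn => (hn₁ n hn).1.1.2.1)
      (fun n hn => (hF n (Finset.mem_filter.1 hn).1).1)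
      (fun n hn => S.h_mono (S.r_pos n) ha (Finset.mem_filter.1 hn).2)
    nlinarith

/-- A finite well-separated family of small balls in a given ball, of large total `h`-volume and
with controlled concentration. -/
lemma exists_layer (S : UbiquitousSystem h U N P r ρ lam) {z R : ℝ} (hR : 0 < R)
    (hU : Metric.closedBall z (2 * R) ⊆ U) {L : ℝ} (hL : 0 < L) (n₀ : ℕ) :
    ∃ V : Finset (Σ _ : ℕ, ℝ), (∀ i ∈ V, n₀ ≤ i.1 ∧ i.2 ∈ P i.1 ∧ |i.2 - z| + r i.1 ≤ 2 * R) ∧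
      (∀ i ∈ V, ∀ j ∈ V, i ≠ j →
        Disjoint (Metric.closedBall i.2 (3 * r i.1)) (Metric.closedBall j.2 (3 * r j.1))) ∧
      L * R / 4 ≤ (15 / (1 - lam) + 120) * ∑ i ∈ V, h (r i.1) ∧
      ∀ x a, 0 < a → ∑ i ∈ V with r i.1 ≤ a ∧ |x - i.2| ≤ a + r i.1, h (r i.1) ≤
        1 / (1 - lam) * h a + 8 * a * L := by
  classical
  obtain ⟨V, hV, hsum, hgrain⟩ := S.exists_family hR hU hL n₀
  obtain ⟨u, huV, hdisj, hcov⟩ := Vitali.exists_disjoint_subfamily_covering_enlargement_closedBall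
    (V : Set (Σ _ : ℕ, ℝ)) (fun i => i.2) (fun i => 3 * r i.1) (6 * R)
    (fun i hi => by have := (hV i hi).2.2.1; have := abs_nonneg (i.2 - z); linarith) 5 (by norm_num)
  lift u to Finset (Σ _ : ℕ, ℝ) using V.finite_toSet.subset huV
  have huV' : ∀ i ∈ u, i ∈ V := fun i hi => huV hi
  have h0 : ∀ i : (Σ _ : ℕ, ℝ), 0 ≤ h (r i.1) := fun i => (S.h_pos _ (S.r_pos _)).le
  have hlam : 0 < 1 - lam := sub_pos.2 S.lam_lt
  refine ⟨u, fun i hi => ⟨(hV i (huV' i hi)).1, (hV i (huV' i hi)).2.1, (hV i (huV' i hi)).2.2.1⟩,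
    fun i hi j hj hij => hdisj hi hj hij, ?_, ?_⟩
  · have hcov' : ∀ i ∈ V, ∃ j ∈ u, r i.1 ≤ 15 * r j.1 ∧ |j.2 - i.2| ≤ 15 * r j.1 + r i.1 := by
      intro i hi
      obtain ⟨j, hj, hij⟩ := hcov i hi
      have hri := S.r_pos i.1
      simp only [Real.closedBall_eq_Icc] at hij
      rw [Set.Icc_subset_Icc_iff (by linarith)] at hij
      obtain ⟨h1, h2⟩ := hij
      refine ⟨j, hj, by linarith, ?_⟩
      rw [abs_le]; constructor <;> linarith
    choose! φ hφu hφ using hcov'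
    refine hsum.trans ?_
    rw [← Finset.sum_fiberwise_of_maps_to hφu, Finset.mul_sum]
    refine Finset.sum_le_sum fun j hj => ?_
    have hrj := S.r_pos j.1
    have hsub : (∑ i ∈ V with φ i = j, h (r i.1)) ≤
        ∑ i ∈ V with r i.1 ≤ 15 * r j.1 ∧ |j.2 - i.2| ≤ 15 * r j.1 + r i.1, h (r i.1) := by
      refine Finset.sum_le_sum_of_subset_of_nonneg ?_ fun i _ _ => h0 i
      intro i hi
      rw [Finset.mem_filter] at hi ⊢
      have := hφ i hi.1
      rw [hi.2] at this
      exact ⟨hi.1, this⟩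
    have h1 := hgrain j.2 (15 * r j.1) (by positivity)
    have h2 := S.h_anti hrj (show 15 * r j.1 ∈ Set.Ioi 0 by simpa using hrj) (by linarith)
    simp only at h2
    rw [div_le_div_iff₀ (by positivity) hrj] at h2
    have h3 : h (15 * r j.1) ≤ 15 * h (r j.1) := by
      refine le_of_mul_le_mul_right ?_ hrj
      linarith
    have h4 := (hV j (huV' j hj)).2.2.2
    have h5 : 1 / (1 - lam) * h (15 * r j.1) ≤ 1 / (1 - lam) * (15 * h (r j.1)) := by gcongr
    have e : (15 / (1 - lam) + 120) * h (r j.1) =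
        1 / (1 - lam) * (15 * h (r j.1)) + 120 * h (r j.1) := by ring
    rw [e]
    linarith
  · intro x a ha
    refine le_trans ?_ (hgrain x a ha)
    exact Finset.sum_le_sum_of_subset_of_nonneg
      (Finset.filter_subset_filter _ fun i hi => huV' i hi) fun i _ _ => h0 i

variable {x a : ℕ → ℝ}

lemma le_hitSum (S : UbiquitousSystem h U N P r ρ lam) (ha : ∀ k, 0 < a k)
    (hsum : Summable fun k => h (a k)) {z s : ℝ} {k : ℕ} (hk : |x k - z| ≤ a k + s) :
    h (a k) ≤ hitSum h x a z s := by
  have h1 := (hsum.indicator {k | |x k - z| ≤ a k + s}).le_tsum k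
    fun j _ => Set.indicator_nonneg (fun n _ => (S.h_pos _ (ha n)).le) j
  rwa [Set.indicator_of_mem (by exact hk)] at h1

lemma hitSum_le (S : UbiquitousSystem h U N P r ρ lam) (ha : ∀ k, 0 < a k)
    (hsum : Summable fun k => h (a k)) (z s : ℝ) :
    hitSum h x a z s ≤ ∑' k, h (a k) :=
  (hsum.indicator _).tsum_le_tsum
    (fun k => Set.indicator_le_self' (fun _ _ => (S.h_pos _ (ha _)).le) k) hsum

/-- If a cover is light on a ball, then it is light on some small ball of the system inside. -/
lemma exists_light_ball (S : UbiquitousSystem h U N P r ρ lam) {K c : ℝ}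
    (hK : K = 16 * (15 / (1 - lam) + 120)) (hc : c = 1 / (1 / (1 - lam) + 8 * K))
    (ha : ∀ k, 0 < a k) (hsum : Summable fun k => h (a k)) {z R : ℝ} (hR : 0 < R)
    (hU : Metric.closedBall z R ⊆ U) {s : ℝ} (hs : 0 < s) (hlight : hitSum h x a z R < c * s)
    (hsmall : ∀ k, |x k - z| ≤ a k + R → s * a k ≤ R * h (a k)) (n₀ : ℕ) :
    ∃ n p, n₀ ≤ n ∧ p ∈ P n ∧ |p - z| + r n ≤ R ∧ hitSum h x a p (r n) < c * h (r n) := by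
  classical
  have hlam : 0 < 1 - lam := sub_pos.2 S.lam_lt
  have hK0 : 0 < K := by rw [hK]; positivity
  have hc0 : 0 < c := by rw [hc]; positivity
  have hcK : (1 / (1 - lam) + 8 * K) * c = 1 := by
    rw [hc]; field_simp
  have hh0 : ∀ k, 0 ≤ h (a k) := fun k => (S.h_pos _ (ha k)).le
  obtain ⟨V, hV, hdisj, hmass, hgrain⟩ := S.exists_layer (z := z) (R := R / 2) (half_pos hR)
    (by rwa [mul_div_cancel₀ _ two_ne_zero]) (L := K * s / R) (by positivity) n₀
  by_contra! hcon
  have hVs : ∀ i ∈ V, c * h (r i.1) ≤ hitSum h x a i.2 (r i.1) := fun i hi => by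
    refine hcon i.1 i.2 (hV i hi).1 (hV i hi).2.1 ?_
    have := (hV i hi).2.2
    linarith
  have hhit : ∀ i ∈ V, ∀ k, |x k - i.2| ≤ a k + r i.1 → |x k - z| ≤ a k + R := by
    intro i hi k hk
    have h1 := (hV i hi).2.2
    have h2 := abs_sub_le (x k) i.2 z
    linarith
  set bad : (Σ _ : ℕ, ℝ) → Prop := fun i => ∃ k, r i.1 ≤ a k ∧ |x k - i.2| ≤ a k + r i.1
  have hbad : ∑ i ∈ V with bad i, h (r i.1) ≤
      (1 / (1 - lam) + 8 * K) * hitSum h x a z R := by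
    have hch : ∀ i ∈ V.filter bad, ∃ k, r i.1 ≤ a k ∧ |x k - i.2| ≤ a k + r i.1 :=
      fun i hi => (Finset.mem_filter.1 hi).2
    choose! φ hφ using hch
    rw [← Finset.sum_fiberwise_of_maps_to (t := (V.filter bad).image φ)
      (fun i hi => Finset.mem_image_of_mem φ hi)]
    calc _ ≤ ∑ k ∈ (V.filter bad).image φ, (1 / (1 - lam) + 8 * K) *
          {k | |x k - z| ≤ a k + R}.indicator (fun k => h (a k)) k := by
          refine Finset.sum_le_sum fun k hk => ?_
          have hkz : |x k - z| ≤ a k + R := by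
            obtain ⟨i, hi, rfl⟩ := Finset.mem_image.1 hk
            exact hhit i (Finset.mem_filter.1 hi).1 _ (hφ i hi).2
          rw [Set.indicator_of_mem (by exact hkz)]
          have h1 : ∑ i ∈ (V.filter bad) with φ i = k, h (r i.1) ≤
              ∑ i ∈ V with r i.1 ≤ a k ∧ |x k - i.2| ≤ a k + r i.1, h (r i.1) := by
            refine Finset.sum_le_sum_of_subset_of_nonneg ?_ fun i _ _ => (S.h_pos _ (S.r_pos _)).le
            intro i hi
            rw [Finset.mem_filter] at hi
            rw [Finset.mem_filter]
            refine ⟨(Finset.mem_filter.1 hi.1).1, ?_⟩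
            have := hφ i hi.1
            rwa [hi.2] at this
          have h2 := hgrain (x k) (a k) (ha k)
          have h3 := hsmall k hkz
          have h4 : 8 * a k * (K * s / R) ≤ 8 * K * h (a k) := by
            rw [mul_div_assoc', div_le_iff₀ hR]
            nlinarith
          linarith
      _ ≤ _ := by
          rw [← Finset.mul_sum]
          refine mul_le_mul_of_nonneg_left ?_ (by positivity)
          exact (hsum.indicator _).sum_le_tsum _
            fun k _ => Set.indicator_nonneg (fun n _ => hh0 n) k
  have hgood : c * ∑ i ∈ V with ¬ bad i, h (r i.1) ≤ hitSum h x a z R := by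
    calc c * ∑ i ∈ V with ¬ bad i, h (r i.1)
        ≤ ∑ i ∈ V with ¬ bad i, hitSum h x a i.2 (r i.1) := by
          rw [Finset.mul_sum]
          exact Finset.sum_le_sum fun i hi => hVs i (Finset.mem_filter.1 hi).1
      _ = ∑' k, ∑ i ∈ V with ¬ bad i,
          {k | |x k - i.2| ≤ a k + r i.1}.indicator (fun k => h (a k)) k :=
          (Summable.tsum_finsetSum fun i _ => hsum.indicator _).symm
      _ ≤ hitSum h x a z R := by
          refine (summable_sum fun i _ => hsum.indicator _).tsum_le_tsum ?_ (hsum.indicator _)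
          intro k
          by_cases hex : ∃ i ∈ V.filter (¬ bad ·), |x k - i.2| ≤ a k + r i.1
          · obtain ⟨i, hi, hik⟩ := hex
            have hiV := (Finset.mem_filter.1 hi).1
            have hnear : ∀ j ∈ V.filter (¬ bad ·), |x k - j.2| ≤ a k + r j.1 →
                x k ∈ Metric.closedBall j.2 (3 * r j.1) := by
              intro j hj hjk
              have h1 : a k < r j.1 := by
                by_contra hle
                exact (Finset.mem_filter.1 hj).2 ⟨k, not_lt.1 hle, hjk⟩
              rw [Metric.mem_closedBall, Real.dist_eq]
              have := S.r_pos j.1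
              linarith
            rw [Finset.sum_eq_single_of_mem i hi]
            · rw [Set.indicator_of_mem (by exact hik),
                Set.indicator_of_mem (by exact hhit i hiV k hik)]
            · intro j hj hji
              refine Set.indicator_of_notMem (fun hjk => ?_) _
              exact Set.disjoint_left.1 (hdisj j (Finset.mem_filter.1 hj).1 i hiV hji)
                (hnear j hj hjk) (hnear i hi hik)
          · push Not at hex
            refine (Finset.sum_eq_zero fun i hi => ?_).trans_le (?_ : (0 : ℝ) ≤ _)
            · exact Set.indicator_of_notMem (s := {k | |x k - i.2| ≤ a k + r i.1})
                (f := fun k => h (a k)) (fun hik => absurd hik (not_le.2 (hex i hi)))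
            · exact Set.indicator_nonneg (fun n _ => hh0 n) k
  have hsplit := Finset.sum_filter_add_sum_filter_not V bad fun i => h (r i.1)
  have hL : K * s / R * (R / 2) / 4 = 2 * (15 / (1 - lam) + 120) * s := by
    rw [hK]; field_simp; norm_num
  rw [hL, mul_comm 2, mul_assoc] at hmass
  have hmass' := le_of_mul_le_mul_left hmass (by positivity)
  have h1 : (1 / (1 - lam) + 8 * K) * hitSum h x a z R <
      (1 / (1 - lam) + 8 * K) * (c * s) := by gcongr
  rw [← mul_assoc, hcK, one_mul] at h1
  have h2 : ∑ i ∈ V with ¬ bad i, h (r i.1) < s := lt_of_mul_lt_mul_left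
    (hgood.trans_lt hlight) hc0.le
  linarith

/-- A cover by small intervals of bounded total `h`-volume misses a point which is infinitely
often close to the system. -/
lemma exists_not_mem_cover (S : UbiquitousSystem h U N P r ρ lam) {z R : ℝ} (hR : 0 < R)
    (hU : Metric.closedBall z R ⊆ U) (M : ℝ) (hM : 0 ≤ M) :
    ∃ η > 0, ∀ x a : ℕ → ℝ, (∀ k, 0 < a k) → (∀ k, a k ≤ η) → (Summable fun k => h (a k)) →
      ∑' k, h (a k) ≤ M →
      ∃ y ∈ U, (∀ n₀, ∃ n, n₀ ≤ n ∧ ∃ p ∈ P n, |y - p| ≤ r n) ∧ ∀ k, a k < |x k - y| := by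
  have hlam : 0 < 1 - lam := sub_pos.2 S.lam_lt
  obtain ⟨K, hK⟩ : ∃ K, K = 16 * (15 / (1 - lam) + 120) := ⟨_, rfl⟩
  obtain ⟨c, hc⟩ : ∃ c, c = 1 / (1 / (1 - lam) + 8 * K) := ⟨_, rfl⟩
  have hK0 : 1 ≤ K := by
    have : 0 < 15 / (1 - lam) := by positivity
    rw [hK]; linarith
  have hc0 : 0 < c := by rw [hc]; positivity
  have hc1 : c ≤ 1 := by
    have : 0 < 1 / (1 - lam) := by positivity
    rw [hc, div_le_one (by positivity)]; linarith
  set s := (M + 1) / c with hs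
  have hs0 : 0 < s := by positivity
  obtain ⟨η, hη, hηs⟩ : ∃ η > 0, ∀ b, 0 < b → b ≤ η → s / R ≤ h b / b := by
    have := S.h_inf.eventually (eventually_ge_atTop (s / R))
    obtain ⟨η, hη, h1⟩ := mem_nhdsGT_iff_exists_Ioc_subset.1 this
    exact ⟨η, hη, fun b hb hbη => h1 ⟨hb, hbη⟩⟩
  refine ⟨η, hη, fun x a ha haη hsum hsumM => ?_⟩
  have hfirst : ∃ n p, 0 ≤ n ∧ p ∈ P n ∧ |p - z| + r n ≤ R ∧
      hitSum h x a p (r n) < c * h (r n) := by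
    refine S.exists_light_ball hK hc ha hsum hR hU hs0 ?_ ?_ 0
    · have := S.hitSum_le (x := x) ha hsum z R
      rw [hs, mul_div_cancel₀ _ hc0.ne']
      linarith
    · intro k _
      have := hηs (a k) (ha k) (haη k)
      rw [div_le_div_iff₀ hR (ha k)] at this
      linarith
  set T := {i : ℕ × ℝ // i.2 ∈ P i.1 ∧ |i.2 - z| + r i.1 ≤ R ∧
    hitSum h x a i.2 (r i.1) < c * h (r i.1)}
  have hnext : ∀ i : T, ∃ j : T, i.1.1 < j.1.1 ∧ |j.1.2 - i.1.2| + r j.1.1 ≤ r i.1.1 := by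
    rintro ⟨⟨n, p⟩, hp, hpz, hlight⟩
    have hrn := S.r_pos n
    have hsub : Metric.closedBall p (r n) ⊆ U := by
      refine (Metric.closedBall_subset_closedBall' ?_).trans hU
      rw [Real.dist_eq]; linarith
    have hsmall : ∀ k, |x k - p| ≤ a k + r n → h (r n) * a k ≤ r n * h (a k) := by
      intro k hk
      have h1 := S.le_hitSum ha hsum hk
      have h2 := S.h_pos _ hrn
      have h3 : h (a k) < h (r n) := by
        simp only at hlight
        nlinarith
      have h4 : a k ≤ r n := by
        by_contra hlt
        exact absurd (S.h_mono hrn (ha k) (not_le.1 hlt).le) (not_le.2 h3)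
      have h5 := S.h_anti (ha k) hrn h4
      simp only at h5
      rw [div_le_div_iff₀ hrn (ha k)] at h5
      linarith
    obtain ⟨m, p', hm, hp', hin, hl⟩ := S.exists_light_ball hK hc ha hsum hrn hsub
      (S.h_pos _ hrn) hlight hsmall (n + 1)
    refine ⟨⟨(m, p'), hp', ?_, hl⟩, hm, hin⟩
    have := abs_sub_le p' p z
    simp only at hpz ⊢
    linarith
  choose nxt hnxt1 hnxt2 using hnext
  obtain ⟨n, p, -, hp, hpz, hl⟩ := hfirst
  set i : ℕ → T := fun m => nxt^[m] ⟨(n, p), hp, hpz, hl⟩ with hi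
  have hisucc : ∀ m, i (m + 1) = nxt (i m) := fun m => Function.iterate_succ_apply' _ _ _
  have hmono : StrictMono fun m => (i m).1.1 := strictMono_nat_of_lt_succ fun m => by
    rw [hisucc]; exact hnxt1 _
  obtain ⟨y, hy⟩ := IsCompact.nonempty_iInter_of_sequence_nonempty_isCompact_isClosed
    (fun m => Metric.closedBall (i m).1.2 (r (i m).1.1))
    (fun m => by
      refine Metric.closedBall_subset_closedBall' ?_
      rw [hisucc, Real.dist_eq, add_comm]
      exact hnxt2 _)
    (fun m => Metric.nonempty_closedBall.2 (S.r_pos _).le)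
    (isCompact_closedBall _ _) (fun m => Metric.isClosed_closedBall)
  rw [Set.mem_iInter] at hy
  have hyd : ∀ m, |y - (i m).1.2| ≤ r (i m).1.1 := fun m => by
    have := hy m
    rwa [Metric.mem_closedBall, Real.dist_eq] at this
  refine ⟨y, hU ?_, fun n₀ => ?_, fun k => ?_⟩
  · rw [Metric.mem_closedBall, Real.dist_eq]
    have h1 := (i 0).2.2.1
    have h2 := hyd 0
    have h3 := abs_sub_le y (i 0).1.2 z
    linarith
  · exact ⟨(i n₀).1.1, hmono.id_le n₀, (i n₀).1.2, (i n₀).2.1, hyd n₀⟩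
  · by_contra! hle
    have h1 : ∀ m, h (a k) ≤ h (r (i m).1.1) := by
      intro m
      have h2 : |x k - (i m).1.2| ≤ a k + r (i m).1.1 := by
        have := abs_sub_le (x k) y (i m).1.2
        have := hyd m
        linarith
      have h3 := S.le_hitSum ha hsum h2
      have h4 := (i m).2.2.2
      have h5 := S.h_pos _ (S.r_pos (i m).1.1)
      nlinarith
    have h6 : Tendsto (fun m => h (r (i m).1.1)) atTop (nhds 0) :=
      (S.h_zero.comp S.r_tendsto').comp hmono.tendsto_atTop
    have h7 := ge_of_tendsto' h6 h1
    exact absurd (S.h_pos _ (ha k)) (not_lt.2 h7)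

end UbiquitousSystem

lemma summable_mul_of_summable_condensed {φ : ℕ → ℝ} {b : ℕ} (hb : 1 < b)
    (h0 : ∀ n, 0 < n → 0 ≤ φ n) (hanti : ∀ m n, 0 < m → m ≤ n → φ n ≤ φ m)
    (hs : Summable fun n : ℕ => ((b : ℝ) ^ n) ^ 2 * φ (b ^ n)) :
    Summable fun n : ℕ => (n : ℝ) * φ n := by
  have hb0 : 0 < b := by omega
  have hg0 : ∀ n : ℕ, 0 ≤ (n : ℝ) * φ n := by
    intro n
    rcases Nat.eq_zero_or_pos n with rfl | hn
    · simp
    · exact mul_nonneg n.cast_nonneg (h0 n hn)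
  have hblock : ∀ k : ℕ, ∑ n ∈ Finset.range (b ^ k), (n : ℝ) * φ n ≤
      ∑ i ∈ Finset.range k, (b : ℝ) ^ 2 * (((b : ℝ) ^ i) ^ 2 * φ (b ^ i)) := by
    intro k
    induction k with
    | zero => simp
    | succ k ih =>
      rw [Finset.sum_range_succ _ k,
        ← Finset.sum_range_add_sum_Ico _ (Nat.pow_le_pow_right hb0 k.le_succ)]
      refine add_le_add ih ?_
      calc ∑ n ∈ Finset.Ico (b ^ k) (b ^ (k + 1)), (n : ℝ) * φ n
          ≤ ∑ n ∈ Finset.Ico (b ^ k) (b ^ (k + 1)), (b : ℝ) ^ (k + 1) * φ (b ^ k) := by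
            refine Finset.sum_le_sum fun n hn => ?_
            rw [Finset.mem_Ico] at hn
            have hp : 0 < b ^ k := Nat.pow_pos hb0
            have h1 : (n : ℝ) ≤ (b : ℝ) ^ (k + 1) := by exact_mod_cast hn.2.le
            exact mul_le_mul h1 (hanti _ _ hp hn.1) (h0 n (hp.trans_le hn.1)) (by positivity)
        _ ≤ (b : ℝ) ^ (k + 1) * ((b : ℝ) ^ (k + 1) * φ (b ^ k)) := by
            rw [Finset.sum_const, nsmul_eq_mul, Nat.card_Ico]
            have h1 := h0 _ (Nat.pow_pos hb0 : 0 < b ^ k)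
            have h2 : ((b ^ (k + 1) - b ^ k : ℕ) : ℝ) ≤ (b : ℝ) ^ (k + 1) := by
              exact_mod_cast Nat.sub_le _ _
            gcongr
        _ = _ := by ring
  refine summable_of_sum_range_le hg0 (c := ∑' i, (b : ℝ) ^ 2 * (((b : ℝ) ^ i) ^ 2 * φ (b ^ i)))
    fun n => ?_
  calc ∑ i ∈ Finset.range n, (i : ℝ) * φ i
      ≤ ∑ i ∈ Finset.range (b ^ n), (i : ℝ) * φ i :=
        Finset.sum_le_sum_of_subset_of_nonneg
          (Finset.range_mono (Nat.lt_pow_self hb).le) fun i _ _ => hg0 i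
    _ ≤ _ := hblock n
    _ ≤ _ := (hs.mul_left _).sum_le_tsum _ fun i _ => by
        have := h0 _ (Nat.pow_pos hb0 : 0 < b ^ i)
        positivity

lemma not_summable_truncated {ψ h : ℝ → ℝ} (hψ : IsApproxFun ψ) (hdim : IsDimFun h)
    (hinf : Tendsto (fun r : ℝ => h r / r) (nhdsWithin 0 (Set.Ioi 0)) atTop)
    (hdiv : ¬ Summable (fun r : ℕ => (r : ℝ) * ψ r * h (ψ r / r))) {b : ℕ} (hb : 1 < b) :
    ¬ Summable fun n : ℕ => ((b : ℝ) ^ n) ^ 2 * min (ψ ((b : ℝ) ^ n)) 1 *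
      h (min (ψ ((b : ℝ) ^ n)) 1 / (b : ℝ) ^ n) := by
  intro hs
  have hb1 : (1 : ℝ) < b := by exact_mod_cast hb
  have hbn : ∀ n : ℕ, 0 < (b : ℝ) ^ n := fun n => by positivity
  obtain ⟨hmono, -, hpos, -⟩ := hdim
  by_cases hall : ∀ n : ℕ, 1 ≤ ψ ((b : ℝ) ^ n)
  · have hinv : Tendsto (fun n : ℕ => ((b : ℝ) ^ n)⁻¹) atTop (nhdsWithin 0 (Set.Ioi 0)) :=
      tendsto_nhdsWithin_iff.2 ⟨tendsto_inv_atTop_zero.comp (tendsto_pow_atTop_atTop_of_one_lt hb1),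
        Eventually.of_forall fun n => inv_pos.2 (hbn n)⟩
    have h1 := (hinf.comp hinv).eventually (eventually_ge_atTop 1)
    have h2 := hs.tendsto_atTop_zero.eventually (gt_mem_nhds one_pos)
    obtain ⟨n, h1, h2⟩ := (h1.and h2).exists
    rw [min_eq_right (hall n), one_div, mul_one] at h2
    simp only [Function.comp, div_inv_eq_mul] at h1
    have h3 : 1 ≤ (b : ℝ) ^ n := one_le_pow₀ hb1.le
    nlinarith
  · push Not at hall
    obtain ⟨m, hm⟩ := hall
    refine hdiv ?_
    have hφ : Summable fun n : ℕ => ((b : ℝ) ^ n) ^ 2 *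
        (ψ ((b ^ n : ℕ) : ℝ) * h (ψ ((b ^ n : ℕ) : ℝ) / ((b ^ n : ℕ) : ℝ))) := by
      rw [← summable_nat_add_iff m] at hs ⊢
      refine hs.congr fun n => ?_
      have h1 : ψ ((b : ℝ) ^ (n + m)) ≤ ψ ((b : ℝ) ^ m) :=
        hψ.1 _ _ (hbn m) (pow_le_pow_right₀ hb1.le (by omega))
      rw [min_eq_left (h1.trans hm.le)]
      push_cast
      ring
    refine (summable_mul_of_summable_condensed (φ := fun n => ψ n * h (ψ n / n)) hb
      (fun n hn => ?_) (fun k n hk hkn => ?_) hφ).congr fun n => by ring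
    · have hn' : (0 : ℝ) < n := by exact_mod_cast hn
      have := hψ.2 n hn'
      have := hpos _ (div_pos this hn')
      positivity
    · have hk' : (0 : ℝ) < k := by exact_mod_cast hk
      have hkn' : (k : ℝ) ≤ n := by exact_mod_cast hkn
      have hn' := hk'.trans_le hkn'
      have h1 := hψ.1 _ _ hk' hkn'
      have h2 := hψ.2 n hn'
      have h3 := hpos _ (div_pos h2 hn')
      have h4 : h (ψ n / n) ≤ h (ψ k / k) := by
        refine hmono (div_pos h2 hn') (div_pos (h2.trans_le h1) hk') ?_
        gcongr
        exact h2.le.trans h1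
      exact mul_le_mul h1 h4 h3.le (h2.le.trans h1)

/-- The levels where `δ n` is too small for counting rational points do not contribute. -/
lemma summable_sparse_levels {h : ℝ → ℝ} (hpos : ∀ r, 0 < r → 0 < h r) {ε : ℝ} (hε : 0 < ε)
    (hε1 : ε ≤ 1)
    (hlim : Tendsto (fun r : ℝ => h r / r ^ ((1 : ℝ) / 2 + ε))
      (nhdsWithin 0 (Set.Ioi 0)) (nhds 0)) {b : ℕ} (hb : 1 < b) {δ : ℕ → ℝ}
    (hδ0 : ∀ n, 0 < δ n) (hδ1 : ∀ n, δ n ≤ 1) :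
    Summable ({n | ((b : ℝ) ^ n) ^ (ε / 2) ≤ δ n * (b : ℝ) ^ n}ᶜ.indicator
      fun n : ℕ => ((b : ℝ) ^ n) ^ 2 * δ n * h (δ n / (b : ℝ) ^ n)) := by
  have hb1 : (1 : ℝ) < b := by exact_mod_cast hb
  have hbn : ∀ n : ℕ, 0 < (b : ℝ) ^ n := fun n => by positivity
  have hpow : Tendsto (fun n : ℕ => (b : ℝ) ^ n) atTop atTop :=
    tendsto_pow_atTop_atTop_of_one_lt hb1
  have hs0 : Tendsto (fun n => δ n / (b : ℝ) ^ n) atTop (nhdsWithin 0 (Set.Ioi 0)) := by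
    refine tendsto_nhdsWithin_iff.2 ⟨?_, Eventually.of_forall fun n => div_pos (hδ0 n) (hbn n)⟩
    refine squeeze_zero (fun n => (div_pos (hδ0 n) (hbn n)).le) (fun n => ?_)
      (tendsto_inv_atTop_zero.comp hpow)
    rw [Function.comp, inv_eq_one_div]
    exact div_le_div_of_nonneg_right (hδ1 n) (hbn n).le
  have hev := (hlim.comp hs0).eventually (gt_mem_nhds one_pos)
  have hgeo : Summable fun n : ℕ => ((b : ℝ) ^ (-(3 / 4 * ε))) ^ n :=
    summable_geometric_of_lt_one (by positivity)
      (Real.rpow_lt_one_of_one_lt_of_neg hb1 (by linarith))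
  refine hgeo.of_norm_bounded_eventually_nat ?_
  filter_upwards [hev] with n hn
  by_cases hnN : n ∈ {n | ((b : ℝ) ^ n) ^ (ε / 2) ≤ δ n * (b : ℝ) ^ n}ᶜ
  swap
  · rw [Set.indicator_of_notMem hnN, norm_zero]; positivity
  rw [Set.indicator_of_mem hnN]
  simp only [Set.mem_compl_iff, Set.mem_ofPred_eq, not_le] at hnN
  have hB1 : 1 ≤ (b : ℝ) ^ n := one_le_pow₀ hb1.le
  have hexp : ((b : ℝ) ^ (-(3 / 4 * ε))) ^ n = ((b : ℝ) ^ n) ^ (-(3 / 4 * ε)) := by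
    rw [← Real.rpow_natCast, ← Real.rpow_mul (by positivity), mul_comm,
      Real.rpow_mul (by positivity), Real.rpow_natCast]
  rw [hexp]
  simp only [Function.comp] at hn
  have hδ := hδ0 n
  generalize (b : ℝ) ^ n = B at *
  generalize δ n = d at *
  have hB0 : 0 < B := by linarith
  have hs : 0 < d / B := by positivity
  have hh := hpos _ hs
  have h1 : h (d / B) ≤ (d / B) ^ (1 / 2 + ε) := by
    rw [div_lt_one (by positivity)] at hn
    exact hn.le
  have h2 : d / B ≤ B ^ (ε / 2 - 2) := by
    rw [Real.rpow_sub hB0, div_le_div_iff₀ hB0 (by positivity), Real.rpow_two]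
    nlinarith
  rw [Real.norm_of_nonneg (by positivity)]
  calc B ^ 2 * d * h (d / B) ≤ B ^ 2 * d * (d / B) ^ (1 / 2 + ε) := by gcongr
    _ = B ^ (3 : ℝ) * (d / B) ^ (3 / 2 + ε) := by
        rw [show 3 / 2 + ε = 1 + (1 / 2 + ε) by ring, Real.rpow_add hs 1, Real.rpow_one,
          show (3 : ℝ) = (3 : ℕ) by norm_num, Real.rpow_natCast]
        field_simp
    _ ≤ B ^ (3 : ℝ) * (B ^ (ε / 2 - 2)) ^ (3 / 2 + ε) := by gcongr
    _ = B ^ (3 + (ε / 2 - 2) * (3 / 2 + ε)) := by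
        rw [← Real.rpow_mul hB0.le, ← Real.rpow_add hB0]
    _ ≤ B ^ (-(3 / 4 * ε)) := by
        refine Real.rpow_le_rpow_of_exponent_le hB1 ?_
        nlinarith

lemma nearRational_mono {f : ℝ → ℝ} {U V : Set ℝ} (hUV : U ⊆ V) (ε X δ : ℝ) :
    nearRational f U ε X δ ⊆ nearRational f V ε X δ :=
  fun _ hy => ⟨hUV hy.1, hy.2⟩

/-- The rational points near a curve with positive second derivative form a ubiquitous system. -/
lemma exists_ubiquitousSystem {f f₁ f₂ : ℝ → ℝ} {c₁ c₂ : ℝ} {U : Set ℝ} (hc₁ : 0 < c₁)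
    (hc₁1 : c₁ ≤ 1) (hc₂ : 1 ≤ c₂) (hf : ∀ x ∈ U, HasDerivAt f (f₁ x) x)
    (hf₁ : ∀ x ∈ U, HasDerivAt f₁ (f₂ x) x) (hf₂ : ∀ x ∈ U, f₂ x ∈ Set.Icc c₁ c₂)
    {ψ h : ℝ → ℝ} (hψ : IsApproxFun ψ) (hdim : IsDimFun h)
    (hinf : Tendsto (fun r : ℝ => h r / r) (nhdsWithin 0 (Set.Ioi 0)) atTop)
    (hdec : AntitoneOn (fun r : ℝ => h r / r) (Set.Ioi 0))
    (heps : ∃ ε₀ > (0 : ℝ), ∀ ε : ℝ, 0 < ε → ε < ε₀ →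
      Tendsto (fun r : ℝ => h r / r ^ ((1 : ℝ) / 2 + ε))
        (nhdsWithin 0 (Set.Ioi 0)) (nhds 0))
    (hgrowth : ∃ r₀ l₁ l₂ : ℝ, r₀ ∈ Set.Ioo (0 : ℝ) 1 ∧ l₁ ∈ Set.Ioo (0 : ℝ) 1 ∧
      l₂ ∈ Set.Ioo (0 : ℝ) 1 ∧ ∀ r : ℝ, 0 < r → r < r₀ → h (l₁ * r) ≤ l₂ * h r)
    (hdiv : ¬ Summable (fun r : ℕ => (r : ℝ) * ψ r * h (ψ r / r)))
    {c₀ : ℝ} (hc₀ : 0 < c₀) (hc₀1 : c₀ ≤ 1) :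
    ∃ (b : ℕ) (ε lam : ℝ) (N : Set ℕ) (ρ : ℕ → ℝ), 1 < b ∧ 0 < ε ∧
      UbiquitousSystem h U N
        (fun n => nearRational f U ε ((b : ℝ) ^ n) (min (ψ ((b : ℝ) ^ n)) 1))
        (fun n => c₀ * (min (ψ ((b : ℝ) ^ n)) 1 / (b : ℝ) ^ n)) ρ lam := by
  obtain ⟨ε₀, hε₀, heps⟩ := heps
  obtain ⟨r₀, l₁, l₂, hr₀, hl₁, hl₂, hgr⟩ := hgrowth
  obtain ⟨b, hbl⟩ := exists_nat_gt (max 1 (1 / l₁))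
  have hb1 : (1 : ℝ) < b := (le_max_left _ _).trans_lt hbl
  have hb : 1 < b := by exact_mod_cast hb1
  have hbl₁ : 1 / (b : ℝ) ≤ l₁ := by
    have := (le_max_right _ _).trans_lt hbl
    rw [div_lt_iff₀ hl₁.1] at this
    rw [div_le_iff₀ (by linarith)]
    linarith
  obtain ⟨e, he0, heε, he1⟩ : ∃ e, 0 < e ∧ e < ε₀ ∧ e ≤ 1 :=
    ⟨min (ε₀ / 2) 1, by positivity, (min_le_left _ _).trans_lt (by linarith), min_le_right _ _⟩
  obtain ⟨ε, hε⟩ : ∃ ε, ε = (c₁ / (1152 * c₂)) ^ 4 := ⟨_, rfl⟩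
  have hε0 : 0 < ε := by rw [hε]; positivity
  have hbn : ∀ n : ℕ, 0 < (b : ℝ) ^ n := fun n => by positivity
  have hnot := not_summable_truncated hψ hdim hinf hdiv hb
  obtain ⟨δ, hδ⟩ : ∃ δ : ℕ → ℝ, ∀ n, δ n = min (ψ ((b : ℝ) ^ n)) 1 := ⟨_, fun n => rfl⟩
  simp only [← hδ] at hnot
  have hδ0 : ∀ n, 0 < δ n := fun n => by rw [hδ]; exact lt_min (hψ.2 _ (hbn n)) one_pos
  have hδ1 : ∀ n, δ n ≤ 1 := fun n => by rw [hδ]; exact min_le_right _ _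
  have hδs : ∀ n, δ (n + 1) ≤ δ n := fun n => by
    rw [hδ, hδ]
    exact min_le_min_right _ (hψ.1 _ _ (hbn n) (pow_le_pow_right₀ hb1.le n.le_succ))
  obtain ⟨hmono, -, hpos, hzero⟩ := hdim
  have hsparse := summable_sparse_levels hpos he0 he1 (heps e he0 heε) hb hδ0 hδ1
  obtain ⟨N, hN⟩ : ∃ N : Set ℕ, N = {n | ((b : ℝ) ^ n) ^ (e / 2) ≤ δ n * (b : ℝ) ^ n} := ⟨_, rfl⟩
  rw [← hN] at hsparse
  have hNmem : ∀ n ∈ N, ((b : ℝ) ^ n) ^ (e / 2) ≤ δ n * (b : ℝ) ^ n := fun n hn => by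
    rwa [hN] at hn
  have hr : ∀ n, 0 < c₀ * (δ n / (b : ℝ) ^ n) := fun n => mul_pos hc₀ (div_pos (hδ0 n) (hbn n))
  have hpow : Tendsto (fun n : ℕ => (b : ℝ) ^ n) atTop atTop :=
    tendsto_pow_atTop_atTop_of_one_lt hb1
  have hrt : Tendsto (fun n => c₀ * (δ n / (b : ℝ) ^ n)) atTop (nhds 0) := by
    refine squeeze_zero (fun n => (hr n).le) (fun n => ?_) (tendsto_inv_atTop_zero.comp hpow)
    rw [Function.comp, inv_eq_one_div, mul_div_assoc']
    exact div_le_div_of_nonneg_right (mul_le_one₀ hc₀1 (hδ0 n).le (hδ1 n)) (hbn n).le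
  have hBe : Tendsto (fun n : ℕ => ((b : ℝ) ^ n) ^ (e / 2)) atTop atTop :=
    (tendsto_rpow_atTop (by positivity)).comp hpow
  refine ⟨b, ε, l₂, N, fun n => 16 / (ε ^ 4 * ((b : ℝ) ^ n) ^ 2 * δ n), hb, hε0, ?_⟩
  simp only [← hδ]
  refine ⟨hpos, hmono, hzero, hdec, hinf, hl₂.1.le, hl₂.2, hr, fun n => ?_, hrt, ?_, fun a ha => ?_,
      fun z R hR hzR => ?_, fun hsum => hnot ?_⟩
  · have := hδ0 n; have := hbn n; positivity
  · filter_upwards [hrt.eventually (gt_mem_nhds hr₀.1)] with n hn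
    refine (hmono (hr _) (mul_pos hl₁.1 (hr n)) ?_).trans (hgr _ (hr n) hn)
    calc c₀ * (δ (n + 1) / (b : ℝ) ^ (n + 1)) ≤ c₀ * (δ n / (b : ℝ) ^ (n + 1)) := by
          have := hδs n
          gcongr
      _ = 1 / b * (c₀ * (δ n / (b : ℝ) ^ n)) := by rw [pow_succ]; field_simp
      _ ≤ _ := mul_le_mul_of_nonneg_right hbl₁ (hr n).le
  · filter_upwards [hpow.eventually (eventually_ge_atTop (16 / (ε ^ 4 * a))),
      hBe.eventually (eventually_ge_atTop 1)] with n hn h1 hnN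
    have h2 := h1.trans (hNmem n hnN)
    have h3 := hδ0 n
    have h4 := hbn n
    rw [div_le_iff₀ (by positivity)] at hn ⊢
    calc 16 ≤ (b : ℝ) ^ n * (ε ^ 4 * a) * 1 := by linarith
      _ ≤ (b : ℝ) ^ n * (ε ^ 4 * a) * (δ n * (b : ℝ) ^ n) := by gcongr
      _ = _ := by ring
  · have hcb : ConvexOnBall f f₁ f₂ c₁ c₂ z R := ⟨hc₁, hc₁1, hc₂, hR, fun x hx => hf x (hzR hx),
      fun x hx => hf₁ x (hzR hx), fun x hx => hf₂ x (hzR hx)⟩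
    obtain ⟨Λ, hΛ⟩ := exists_volume_near_nearRational hcb hε
    filter_upwards [hBe.eventually (eventually_ge_atTop Λ)] with n hn hnN
    refine (hΛ _ _ (hδ0 n) (hδ1 n) (hn.trans (hNmem n hnN))).trans (measure_mono ?_)
    rintro x ⟨hx, y, hy, hxy⟩
    exact ⟨hx, y, nearRational_mono hzR _ _ _ hy, hxy⟩
  · have h1 : Summable (N.indicator fun n =>
        ((b : ℝ) ^ n) ^ 2 * δ n * h (δ n / (b : ℝ) ^ n)) := by
      refine Summable.of_nonneg_of_le (fun n => ?_) (fun n => ?_)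
        (hsum.mul_left (16 / (ε ^ 4 * c₀)))
      · refine Set.indicator_nonneg (fun n _ => ?_) n
        have := hδ0 n
        have := hpos _ (div_pos (hδ0 n) (hbn n))
        positivity
      · by_cases hn : n ∈ N
        · rw [Set.indicator_of_mem hn, Set.indicator_of_mem hn]
          have h2 := div_pos (hδ0 n) (hbn n)
          have h3 := hdec (hr n) h2 (mul_le_of_le_one_left h2.le hc₀1)
          simp only at h3
          rw [div_le_div_iff₀ h2 (hr n)] at h3
          have h4 : c₀ * h (δ n / (b : ℝ) ^ n) ≤ h (c₀ * (δ n / (b : ℝ) ^ n)) := by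
            refine le_of_mul_le_mul_right ?_ h2
            linarith
          have h5 := hδ0 n
          have h6 := hbn n
          calc ((b : ℝ) ^ n) ^ 2 * δ n * h (δ n / (b : ℝ) ^ n)
              = ((b : ℝ) ^ n) ^ 2 * δ n / c₀ * (c₀ * h (δ n / (b : ℝ) ^ n)) := by field_simp
            _ ≤ ((b : ℝ) ^ n) ^ 2 * δ n / c₀ * h (c₀ * (δ n / (b : ℝ) ^ n)) := by gcongr
            _ = _ := by field_simp
        · rw [Set.indicator_of_notMem hn, Set.indicator_of_notMem hn, mul_zero]
    exact (h1.add hsparse).congr fun n =>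
      congrFun (Set.indicator_self_add_compl N _) n

lemma distNearestInt_le (x : ℝ) (m : ℤ) : distNearestInt x ≤ |x - m| :=
  round_le x m

lemma distNearestInt_neg (x : ℝ) : distNearestInt (-x) = distNearestInt x := by
  rw [distNearestInt, distNearestInt, ← UnitAddCircle.norm_eq, ← UnitAddCircle.norm_eq,
    AddCircle.coe_neg, norm_neg]

lemma mk_neg_mem_simApprox2_iff {ψ : ℝ → ℝ} {x y : ℝ} :
    (x, -y) ∈ SimApprox2 ψ ↔ (x, y) ∈ SimApprox2 ψ := by
  simp only [SimApprox2, Set.mem_ofPred_eq, mul_neg, distNearestInt_neg]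

/-- A point which lies infinitely often close to the rational points near a curve lifts to a
simultaneously approximable point of the curve. -/
lemma mk_mem_simApprox2 {f ψ : ℝ → ℝ} (hψ : IsApproxFun ψ) {U : Set ℝ} {K c₀ ε : ℝ}
    (hK : ∀ x ∈ U, ∀ y ∈ U, |f x - f y| ≤ K * |x - y|) (hK0 : 0 ≤ K) (hc₀ : 0 < c₀)
    (hc₀1 : c₀ ≤ 1 / 4) (hc₀K : K * c₀ ≤ 1 / 4) (hε : 0 < ε) {b : ℕ} (hb : 1 < b)
    {y : ℝ} (hy : y ∈ U)
    (h : ∀ n₀, ∃ n, n₀ ≤ n ∧ ∃ p ∈ nearRational f U ε ((b : ℝ) ^ n) (min (ψ ((b : ℝ) ^ n)) 1),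
      |y - p| ≤ c₀ * (min (ψ ((b : ℝ) ^ n)) 1 / (b : ℝ) ^ n)) :
    (y, f y) ∈ SimApprox2 ψ := by
  refine Set.infinite_of_forall_exists_gt fun m => ?_
  have hb1 : (1 : ℝ) < b := by exact_mod_cast hb
  obtain ⟨n₀, hn₀⟩ := ((tendsto_pow_atTop_atTop_of_one_lt hb1).eventually
    (eventually_ge_atTop (m * 4 / ε ^ 3))).exists_forall_of_atTop
  obtain ⟨n, hn, p, ⟨hpU, q, p₁, p₂, hq1, hq2, hp, hfp⟩, hyp⟩ := h n₀
  have hX := hn₀ n hn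
  have hX0 : 0 < (b : ℝ) ^ n := by positivity
  have hδ0 : 0 < min (ψ ((b : ℝ) ^ n)) 1 := lt_min (hψ.2 _ hX0) one_pos
  have hδψ : min (ψ ((b : ℝ) ^ n)) 1 ≤ ψ ((b : ℝ) ^ n) := min_le_left _ _
  generalize (b : ℝ) ^ n = X at *
  generalize min (ψ X) 1 = δ at *
  rw [div_le_iff₀ (by positivity)] at hX
  have hmq : (m : ℝ) < q := by nlinarith
  have hq0 : (0 : ℝ) < q := (Nat.cast_nonneg m).trans_lt hmq
  lift q to ℕ using by exact_mod_cast hq0.le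
  rw [Int.cast_natCast] at *
  have hqy : (q : ℝ) * |y - p| ≤ c₀ * δ := by
    calc (q : ℝ) * |y - p| ≤ X * (c₀ * (δ / X)) := by gcongr
      _ = c₀ * δ := by field_simp
  have hψq : δ ≤ ψ q := hδψ.trans (hψ.1 _ _ hq0 hq2)
  refine ⟨q, ⟨by exact_mod_cast hq0, (max_lt ?_ ?_).trans_le hψq⟩, by exact_mod_cast hmq⟩
  · refine (distNearestInt_le _ p₁).trans_lt ?_
    have h1 : (q : ℝ) * y - p₁ = q * (y - p) := by rw [hp]; field_simp
    rw [h1, abs_mul, abs_of_pos hq0]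
    nlinarith
  · refine (distNearestInt_le _ p₂).trans_lt ?_
    have h1 : (q : ℝ) * f y - p₂ = q * (f y - f p) + (q * f p - p₂) := by ring
    have h2 : |(q : ℝ) * (f y - f p)| ≤ K * (c₀ * δ) := by
      rw [abs_mul, abs_of_pos hq0]
      calc (q : ℝ) * |f y - f p| ≤ q * (K * |y - p|) := by
            gcongr; exact hK y hy p hpU
        _ = K * (q * |y - p|) := by ring
        _ ≤ _ := by gcongr
    have h3 := abs_add_le ((q : ℝ) * (f y - f p)) (q * f p - p₂)
    have h4 : K * (c₀ * δ) ≤ 1 / 4 * δ := by rw [← mul_assoc]; gcongr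
    dsimp only
    rw [h1]
    linarith

/-- A set which is not covered by small vertical strips of bounded total `h`-volume has infinite
Hausdorff measure. -/
lemma hausdorffGaugeMeasure_eq_top {h : ℝ → ℝ} (hdim : IsDimFun h) {A : Set (ℝ × ℝ)}
    (hA : ∀ M, 0 ≤ M → ∃ η > 0, ∀ x a : ℕ → ℝ, (∀ k, 0 < a k) → (∀ k, a k ≤ η) →
      (Summable fun k => h (a k)) → ∑' k, h (a k) ≤ M → ∃ y ∈ A, ∀ k, a k < |x k - y.1|) :
    hausdorffGaugeMeasure h A = ⊤ := by
  classical
  by_contra hne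
  obtain ⟨-, -, hpos, hzero⟩ := hdim
  obtain ⟨η, hη, hcov⟩ := hA ((hausdorffGaugeMeasure h A + 1).toReal + 2) (by positivity)
  have hlt : hausdorffGaugeMeasure h A < hausdorffGaugeMeasure h A + 1 :=
    ENNReal.lt_add_right hne one_ne_zero
  obtain ⟨t, hAt, htd, hts⟩ : ∃ t : ℕ → Set (ℝ × ℝ), A ⊆ Set.iUnion t ∧
      (∀ k, Metric.ediam (t k) ≤ ENNReal.ofReal η) ∧
      ∑' k, (⨆ _ : (t k).Nonempty, ENNReal.ofReal (h (Metric.ediam (t k)).toReal)) <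
        hausdorffGaugeMeasure h A + 1 := by
    have h1 : _ ≤ hausdorffGaugeMeasure h A := (le_iSup₂ (ENNReal.ofReal η)
      (ENNReal.ofReal_pos.2 hη)).trans_eq (Measure.mkMetric_apply _ A).symm
    have h2 := h1.trans_lt hlt
    simp only [iInf_lt_iff] at h2
    obtain ⟨t, h3, h4, h5⟩ := h2
    exact ⟨t, h3, h4, h5⟩
  obtain ⟨g, hg⟩ : ∃ g : ℕ → ENNReal, g = fun k => ⨆ _ : (t k).Nonempty,
    ENNReal.ofReal (h (Metric.ediam (t k)).toReal) := ⟨_, rfl⟩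
  rw [← hg] at hts
  have hfin : hausdorffGaugeMeasure h A + 1 ≠ ⊤ := ENNReal.add_ne_top.2 ⟨hne, ENNReal.one_ne_top⟩
  have hgsum : Summable fun k => (g k).toReal := ENNReal.summable_toReal hts.ne_top
  have hgtsum : ∑' k, (g k).toReal ≤ (hausdorffGaugeMeasure h A + 1).toReal := by
    rw [← ENNReal.tsum_toReal_eq fun k => ENNReal.ne_top_of_tsum_ne_top hts.ne_top k]
    exact ENNReal.toReal_mono hfin hts.le
  have hτ : ∀ k : ℕ, ∃ τ, 0 < τ ∧ τ ≤ η ∧ h τ ≤ (1 / 2) ^ k := by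
    intro k
    have h1 := hzero.eventually (ge_mem_nhds (by positivity : (0 : ℝ) < (1 / 2) ^ k))
    obtain ⟨τ, h2, h3, h4⟩ := (h1.and (Ioc_mem_nhdsGT hη)).exists
    exact ⟨τ, h3, h4, h2⟩
  choose τ hτ0 hτη hτh using hτ
  obtain ⟨a, ha⟩ : ∃ a : ℕ → ℝ, ∀ k, a k = if (t k).Nonempty ∧ 0 < (Metric.ediam (t k)).toReal
    then (Metric.ediam (t k)).toReal else τ k := ⟨_, fun k => rfl⟩
  have hd : ∀ k, (Metric.ediam (t k)).toReal ≤ η := fun k =>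
    ENNReal.toReal_le_of_le_ofReal hη.le (htd k)
  have ha0 : ∀ k, 0 < a k := fun k => by
    rw [ha]; split_ifs with hk
    exacts [hk.2, hτ0 k]
  have haη : ∀ k, a k ≤ η := fun k => by
    rw [ha]; split_ifs
    exacts [hd k, hτη k]
  have hah : ∀ k, h (a k) ≤ (g k).toReal + (1 / 2) ^ k := fun k => by
    rw [ha]; split_ifs with hk
    · simp only [hg, hk.1, iSup_pos]
      rw [ENNReal.toReal_ofReal (hpos _ hk.2).le]
      linarith [show (0 : ℝ) < (1 / 2) ^ k by positivity]
    · linarith [hτh k, (g k).toReal_nonneg]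
  have hbig := hgsum.add summable_geometric_two
  have hsum : Summable fun k => h (a k) :=
    hbig.of_nonneg_of_le (fun k => (hpos _ (ha0 k)).le) hah
  have htsum : ∑' k, h (a k) ≤ (hausdorffGaugeMeasure h A + 1).toReal + 2 := by
    refine (hsum.tsum_le_tsum hah hbig).trans ?_
    rw [hgsum.tsum_add summable_geometric_two, tsum_geometric_two]
    linarith
  obtain ⟨y, hyA, hy⟩ := hcov (fun k => if hk : (t k).Nonempty then hk.some.1 else 0) a ha0 haη
    hsum htsum
  obtain ⟨k, hk⟩ := Set.mem_iUnion.1 (hAt hyA)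
  have hne' : (t k).Nonempty := ⟨y, hk⟩
  have h1 := hy k
  simp only [hne', dite_true] at h1
  have h2 : |hne'.some.1 - y.1| ≤ (Metric.ediam (t k)).toReal := by
    have h3 := Metric.edist_le_ediam_of_mem hne'.some_mem hk
    have h4 : dist hne'.some y ≤ (Metric.ediam (t k)).toReal := by
      rw [dist_edist]
      exact ENNReal.toReal_mono (ne_top_of_le_ne_top ENNReal.ofReal_ne_top (htd k)) h3
    refine le_trans ?_ h4
    rw [Prod.dist_eq, ← Real.dist_eq]
    exact le_max_left _ _
  have h3 := ha0 k
  rw [ha] at h1 h3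
  split_ifs at h1 h3 with hc
  · linarith
  · refine hc ⟨hne', ?_⟩
    linarith

/-- On an arc with positive second derivative, the approximable points escape every cover by
small intervals of bounded total `h`-volume. -/
lemma exists_mem_simApprox2_not_mem_cover {f : ℝ → ℝ} {J : Set ℝ} (hJ : IsOpen J)
    (hf : ContDiffOn ℝ 3 f J) {x₀ : ℝ} (hx₀ : x₀ ∈ J) (hx₀f : 0 < deriv (deriv f) x₀)
    {ψ h : ℝ → ℝ} (hψ : IsApproxFun ψ) (hdim : IsDimFun h)
    (hinf : Tendsto (fun r : ℝ => h r / r) (nhdsWithin 0 (Set.Ioi 0)) atTop)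
    (hdec : AntitoneOn (fun r : ℝ => h r / r) (Set.Ioi 0))
    (heps : ∃ ε₀ > (0 : ℝ), ∀ ε : ℝ, 0 < ε → ε < ε₀ →
      Tendsto (fun r : ℝ => h r / r ^ ((1 : ℝ) / 2 + ε))
        (nhdsWithin 0 (Set.Ioi 0)) (nhds 0))
    (hgrowth : ∃ r₀ l₁ l₂ : ℝ, r₀ ∈ Set.Ioo (0 : ℝ) 1 ∧ l₁ ∈ Set.Ioo (0 : ℝ) 1 ∧
      l₂ ∈ Set.Ioo (0 : ℝ) 1 ∧ ∀ r : ℝ, 0 < r → r < r₀ → h (l₁ * r) ≤ l₂ * h r)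
    (hdiv : ¬ Summable (fun r : ℕ => (r : ℝ) * ψ r * h (ψ r / r)))
    (M : ℝ) (hM : 0 ≤ M) :
    ∃ η > 0, ∀ x a : ℕ → ℝ, (∀ k, 0 < a k) → (∀ k, a k ≤ η) → (Summable fun k => h (a k)) →
      ∑' k, h (a k) ≤ M → ∃ y ∈ J, (y, f y) ∈ SimApprox2 ψ ∧ ∀ k, a k < |x k - y| := by
  have hf1 : ContDiffOn ℝ 2 (deriv f) J := hf.deriv_of_isOpen hJ (by norm_num)
  have hf2 : ContDiffOn ℝ 1 (deriv (deriv f)) J := hf1.deriv_of_isOpen hJ (by norm_num)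
  have hJn : ∀ x ∈ J, J ∈ nhds x := fun x hx => hJ.mem_nhds hx
  have hd : ∀ x ∈ J, HasDerivAt f (deriv f x) x := fun x hx =>
    ((hf.contDiffAt (hJn x hx)).differentiableAt (by norm_num)).hasDerivAt
  have hd1 : ∀ x ∈ J, HasDerivAt (deriv f) (deriv (deriv f) x) x := fun x hx =>
    ((hf1.contDiffAt (hJn x hx)).differentiableAt (by norm_num)).hasDerivAt
  have hc := hf1.continuousOn.continuousAt (hJn x₀ hx₀)
  have hc2 := hf2.continuousOn.continuousAt (hJn x₀ hx₀)
  set d := deriv (deriv f) x₀ with hd0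
  set K := |deriv f x₀| + 1 with hK
  have hev : ∀ᶠ x in nhds x₀, x ∈ J ∧ deriv (deriv f) x ∈ Set.Icc (d / 2) (2 * d) ∧
      |deriv f x| ≤ K :=
    Filter.Eventually.and (hJn x₀ hx₀) ((hc2.eventually
      (Icc_mem_nhds (by linarith) (by linarith))).and (hc.abs.eventually (ge_mem_nhds (lt_add_one _))))
  obtain ⟨R, hR, hball⟩ := Metric.nhds_basis_closedBall.eventually_iff.1 hev
  have hK0 : 0 ≤ K := by positivity
  have hLip : ∀ x ∈ Metric.closedBall x₀ R, ∀ y ∈ Metric.closedBall x₀ R,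
      |f x - f y| ≤ K * |x - y| := by
    intro x hx y hy
    exact (convex_closedBall x₀ R).norm_image_sub_le_of_norm_hasDerivWithin_le
      (fun u hu => (hd u (hball hu).1).hasDerivWithinAt) (fun u hu => (hball hu).2.2) hy hx
  obtain ⟨c₀, hc₀, hc₀1, hc₀K⟩ : ∃ c₀ : ℝ, 0 < c₀ ∧ c₀ ≤ 1 / 4 ∧ K * c₀ ≤ 1 / 4 := by
    have hK1 : 1 ≤ K := by rw [hK]; linarith [abs_nonneg (deriv f x₀)]
    refine ⟨1 / (4 * K), by positivity, ?_, ?_⟩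
    · rw [div_le_div_iff₀ (by positivity) (by norm_num)]; linarith
    · rw [mul_one_div, div_le_div_iff₀ (by positivity) (by norm_num)]; linarith
  obtain ⟨b, ε, lam, N, ρ, hb, hε, S⟩ := exists_ubiquitousSystem (f := f) (f₁ := deriv f)
    (f₂ := deriv (deriv f)) (c₁ := min (d / 2) 1) (c₂ := max (2 * d) 1)
    (U := Metric.closedBall x₀ R) (by positivity) (min_le_right _ _) (le_max_right _ _)
    (fun x hx => hd x (hball hx).1) (fun x hx => hd1 x (hball hx).1)
    (fun x hx => ⟨(min_le_left _ _).trans (hball hx).2.1.1,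
      (hball hx).2.1.2.trans (le_max_left _ _)⟩)
    hψ hdim hinf hdec heps hgrowth hdiv hc₀ (hc₀1.trans (by norm_num))
  obtain ⟨η, hη, hcov⟩ := S.exists_not_mem_cover hR subset_rfl M hM
  refine ⟨η, hη, fun x a ha haη hsum hsumM => ?_⟩
  obtain ⟨y, hyU, hnear, hy⟩ := hcov x a ha haη hsum hsumM
  exact ⟨y, (hball hyU).1,
    mk_mem_simApprox2 hψ hLip hK0 hc₀ hc₀1 hc₀K hε hb hyU hnear, hy⟩

/-- A nonzero second derivative within an interval persists to the interior. -/
lemma exists_interior_deriv_deriv_ne_zero {I : Set ℝ} (hI : I.OrdConnected) {f : ℝ → ℝ}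
    (hf : ContDiffOn ℝ 2 f I) (hnd : ∃ x₀ ∈ I, iteratedDerivWithin 2 f I x₀ ≠ 0) :
    ∃ x ∈ interior I, deriv (deriv f) x ≠ 0 := by
  obtain ⟨x₀, hx₀, hne⟩ := hnd
  have hconv : Convex ℝ I := hI.convex
  have hint : (interior I).Nonempty := by
    refine hconv.nontrivial_iff_nonempty_interior.1 (Set.not_subsingleton_iff.1 fun hs => hne ?_)
    rw [iteratedDerivWithin_succ]
    refine derivWithin_zero_of_not_accPt fun hacc => ?_
    obtain ⟨y, hy, hyx⟩ := accPt_iff_nhds.1 hacc Set.univ univ_mem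
    exact hyx (hs hy.2 hx₀)
  have hcont := hf.continuousOn_iteratedDerivWithin (m := 2) (by norm_num)
    (uniqueDiffOn_convex hconv hint)
  have hcl : x₀ ∈ closure (interior I) := by
    rw [hconv.closure_interior_eq_closure_of_nonempty_interior hint]
    exact subset_closure hx₀
  have := mem_closure_iff_nhdsWithin_neBot.1 hcl
  have h1 := ((hcont x₀ hx₀).mono interior_subset).eventually_ne hne
  obtain ⟨x, h2, h3⟩ := (h1.and self_mem_nhdsWithin).exists
  refine ⟨x, h3, ?_⟩
  have h4 : iteratedDerivWithin 2 f I x = iteratedDeriv 2 f x := by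
    refine iteratedDerivWithin_eq_iteratedDeriv (uniqueDiffOn_convex hconv hint) ?_
      (interior_subset h3)
    exact hf.contDiffAt (mem_interior_iff_mem_nhds.1 h3)
  rw [h4, iteratedDeriv_eq_iterate] at h2
  exact h2

theorem general_hausdorff_measure_divergence_on_curve
    (I₀ : Set ℝ) (hI₀ : I₀.OrdConnected)
    (f : ℝ → ℝ) (hf : ContDiffOn ℝ 3 f I₀)
    (hnd : ∃ x₀ ∈ I₀, iteratedDerivWithin 2 f I₀ x₀ ≠ 0)
    (ψ : ℝ → ℝ) (hψ : IsApproxFun ψ)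
    (h : ℝ → ℝ) (hdim : IsDimFun h)
    (hinf : Tendsto (fun r : ℝ => h r / r) (nhdsWithin 0 (Set.Ioi 0)) atTop)
    (hdec : AntitoneOn (fun r : ℝ => h r / r) (Set.Ioi 0))
    (heps : ∃ ε₀ > (0 : ℝ), ∀ ε : ℝ, 0 < ε → ε < ε₀ →
      Tendsto (fun r : ℝ => h r / r ^ ((1 : ℝ) / 2 + ε))
        (nhdsWithin 0 (Set.Ioi 0)) (nhds 0))
    (hgrowth : ∃ r₀ l₁ l₂ : ℝ, r₀ ∈ Set.Ioo (0 : ℝ) 1 ∧ l₁ ∈ Set.Ioo (0 : ℝ) 1 ∧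
      l₂ ∈ Set.Ioo (0 : ℝ) 1 ∧ ∀ r : ℝ, 0 < r → r < r₀ → h (l₁ * r) ≤ l₂ * h r)
    (hdiv : ¬ Summable (fun r : ℕ => (r : ℝ) * ψ r * h (ψ r / r))) :
    hausdorffGaugeMeasure h (((fun x => (x, f x)) '' I₀) ∩ SimApprox2 ψ) = ⊤ := by
  obtain ⟨x₀, hx₀, hne⟩ := exists_interior_deriv_deriv_ne_zero hI₀ (hf.of_le (by norm_num)) hnd
  have hfi : ContDiffOn ℝ 3 f (interior I₀) := hf.mono interior_subset
  refine hausdorffGaugeMeasure_eq_top hdim fun M hM => ?_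
  rcases hne.lt_or_gt with hneg | hpos
  · have hneg' : 0 < deriv (deriv fun x => -f x) x₀ := by
      have h1 : deriv (fun x => -f x) = fun x => -deriv f x := funext fun x => deriv.fun_neg
      rw [h1, deriv.fun_neg]
      linarith
    obtain ⟨η, hη, hcov⟩ := exists_mem_simApprox2_not_mem_cover isOpen_interior hfi.neg hx₀ hneg'
      hψ hdim hinf hdec heps hgrowth hdiv M hM
    refine ⟨η, hη, fun x a ha haη hsum hsumM => ?_⟩
    obtain ⟨y, hyJ, hyS, hy⟩ := hcov x a ha haη hsum hsumM
    exact ⟨(y, f y), ⟨⟨y, interior_subset hyJ, rfl⟩, mk_neg_mem_simApprox2_iff.1 hyS⟩, hy⟩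
  · obtain ⟨η, hη, hcov⟩ := exists_mem_simApprox2_not_mem_cover isOpen_interior hfi hx₀ hpos
      hψ hdim hinf hdec heps hgrowth hdiv M hM
    refine ⟨η, hη, fun x a ha haη hsum hsumM => ?_⟩
    obtain ⟨y, hyJ, hyS, hy⟩ := hcov x a ha haη hsum hsumM
    exact ⟨(y, f y), ⟨⟨y, interior_subset hyJ, rfl⟩, hyS⟩, hy⟩
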